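/- arXiv:1509.08879 — 2 statements merged into one kernel-verified Lean document; each statement's English description precedes it below -/
import Mathlib

section
/- Let ℓ ≥ 1, n ≥ 1, 0 ≤ p ≤ ℓ+1, N = n(ℓ+2)+p+1, and let s = (c₁, c_N) with 0 ≤ c₁, c_N ≤ ℓ. For the M_ℓ model on the open chain of N sites with special boundary conditions s: (i) if 0 ≤ p ≤ ℓ, c₁ ≥ p, c_N ≥ p and c₁ + c_N ≤ ℓ + p, then dim H_Q^f = 1 for f = nℓ+p and dim H_Q^f = 0 for every other f; (ii) if 1 ≤ p ≤ ℓ+1, c₁ < p, c_N < p and c₁ + c_N ≥ p−1, then dim H_Q^f = 1 for f = nℓ+p−1 and dim H_Q^f = 0 for every other f; in all other cases H_Q^f = 0 for every f. Equivalently, the Hamiltonian has exactly one zero-energy ground state in cases (i) and (ii), at fermion numbers nℓ+p and nℓ+p−1 respectively, and none otherwise. -/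
attribute [local instance 10] Classical.propDecidable

noncomputable section

/-- A configuration of `N` sites: `true` = occupied, `false` = empty. -/
abbrev Config (N : ℕ) := Fin N → Bool

/-- Extension of a configuration to all of `ℕ`, by empty sites outside the chain. -/
def extc {N : ℕ} (σ : Config N) (t : ℕ) : Bool :=
  if h : t < N then σ ⟨t, h⟩ else false

/-- The fermion number: the number of occupied sites. -/
def fermions {N : ℕ} (σ : Config N) : ℕ :=
  (Finset.univ.filter fun i => σ i = true).card

/-- Allowed configurations of the open chain of `N` sites with exclusion parameter `ℓ`
and special boundary conditions `(c₁, cN)`: no cluster is longer than `ℓ`, the cluster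
containing the first site (if occupied) has length at most `c₁`, and the cluster
containing the last site (if occupied) has length at most `cN`. -/
def OpenOK (N ℓ c₁ cN : ℕ) (σ : Config N) : Prop :=
  (∀ a : ℕ, ¬ ∀ k ≤ ℓ, extc σ (a + k) = true) ∧
  (¬ (c₁ + 1 ≤ N ∧ ∀ k ≤ c₁, extc σ k = true)) ∧
  (¬ (cN + 1 ≤ N ∧ ∀ k ≤ cN, extc σ (N - 1 - k) = true))

/-- Cyclic shift of a site of the closed chain by `k` steps. -/
def cyc {N : ℕ} (i : Fin N) (k : ℕ) : Fin N :=
  ⟨(i.1 + k) % N, Nat.mod_lt _ i.pos⟩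

/-- Allowed configurations of the closed chain of `N` sites with periodic boundary
conditions: the chain is not fully occupied and no maximal cyclic run of occupied
sites is longer than `ℓ`. -/
def PerOK (N ℓ : ℕ) (σ : Config N) : Prop :=
  ∀ i : Fin N, ∃ k ≤ ℓ, σ (cyc i k) = false

/-- The fermionic sign `(-1)^{#{j < i : σ j = 1}}`. -/
def sgn {N : ℕ} (σ : Config N) (i : Fin N) : ℂ :=
  (-1 : ℂ) ^ ((Finset.univ.filter fun j => j < i ∧ σ j = true).card)

/-- The Hilbert space `V_N`: complex functions on allowed configurations. -/
abbrev AState (N : ℕ) (OK : Config N → Prop) := {σ : Config N // OK σ} → ℂ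

/-- Matrix of the supercharge with amplitudes `A`, with particle insertion
restricted to the sublattice `S`: the entry `(τ, σ)` is the amplitude (with fermionic
sign) for obtaining `τ` from `σ` by occupying an empty site of `S`. -/
def QmatA (N : ℕ) (OK : Config N → Prop) (S : Fin N → Prop)
    (A : Config N → Fin N → ℂ) :
    Matrix {σ : Config N // OK σ} {σ : Config N // OK σ} ℂ := fun τ σ =>
  ∑ i : Fin N,
    if S i ∧ σ.1 i = false ∧ τ.1 = Function.update σ.1 i true
    then A σ.1 i * sgn σ.1 i else 0

/-- The supercharge with amplitudes `A` restricted to the sublattice `S`, as a linear map. -/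
def QopA (N : ℕ) (OK : Config N → Prop) (S : Fin N → Prop)
    (A : Config N → Fin N → ℂ) : AState N OK →ₗ[ℂ] AState N OK :=
  (QmatA N OK S A).mulVecLin

/-- The unit-coupling supercharge restricted to the sublattice `S`. -/
def Qop (N : ℕ) (OK : Config N → Prop) (S : Fin N → Prop) :
    AState N OK →ₗ[ℂ] AState N OK :=
  QopA N OK S fun _ _ => 1

/-- The subspace `V_{N,f}` of states supported on configurations with fermion number `f`. -/
def gradeV (N : ℕ) (OK : Config N → Prop) (f : ℕ) :
    Submodule ℂ (AState N OK) where
  carrier := {ψ | ∀ σ, fermions σ.1 ≠ f → ψ σ = 0}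
  add_mem' := by
    intro a b ha hb σ h
    show a σ + b σ = 0
    rw [ha σ h, hb σ h, add_zero]
  zero_mem' := by intro σ h; rfl
  smul_mem' := by
    intro c a ha σ h
    show c * a σ = 0
    rw [ha σ h, mul_zero]

/-- The cocycles at gradeV `f`: `ker Q ∩ V_{N,f}` (for the supercharge restricted to `S`). -/
def cocycles (N : ℕ) (OK : Config N → Prop) (S : Fin N → Prop) (f : ℕ) :
    Submodule ℂ (AState N OK) :=
  LinearMap.ker (Qop N OK S) ⊓ gradeV N OK f

/-- The coboundaries at gradeV `f`: `Q (V_{N,f-1})` (for the supercharge restricted to `S`). -/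
def cobounds (N : ℕ) (OK : Config N → Prop) (S : Fin N → Prop) (f : ℕ) :
    Submodule ℂ (AState N OK) :=
  (gradeV N OK (f - 1)).map (Qop N OK S)

/-- The cohomology `H_Q^f = ker (Q : V_{N,f} → V_{N,f+1}) / Q (V_{N,f-1})`. -/
abbrev CohSpace (N : ℕ) (OK : Config N → Prop) (S : Fin N → Prop) (f : ℕ) :=
  cocycles N OK S f ⧸ ((cobounds N OK S f).comap (cocycles N OK S f).subtype)

/-- The dimension of `H_Q^f`. -/
def cohDim (N : ℕ) (OK : Config N → Prop) (S : Fin N → Prop) (f : ℕ) : ℕ :=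
  Module.finrank ℂ (CohSpace N OK S f)

/-- The cohomology class represented by a cocycle. -/
def cohClass (N : ℕ) (OK : Config N → Prop) (S : Fin N → Prop) (f : ℕ)
    (ψ : AState N OK) (h : ψ ∈ cocycles N OK S f) : CohSpace N OK S f :=
  Submodule.Quotient.mk ⟨ψ, h⟩

/-- The supercharge on functions of arbitrary configurations. -/
def fullQ (N : ℕ) : (Config N → ℂ) →ₗ[ℂ] (Config N → ℂ) where
  toFun g τ := ∑ i, if τ i = true then sgn τ i * g (Function.update τ i false) else 0
  map_add' g h := by
    ext τ
    simp only [Pi.add_apply, ← Finset.sum_add_distrib]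
    refine Finset.sum_congr rfl fun i _ => ?_
    split_ifs <;> ring
  map_smul' c g := by
    ext τ
    simp only [Pi.smul_apply, smul_eq_mul, RingHom.id_apply, Finset.mul_sum]
    refine Finset.sum_congr rfl fun i _ => ?_
    split_ifs <;> ring

/-- Removal of a particle from site `i`, on functions of arbitrary configurations. -/
def fullH {N : ℕ} (i : Fin N) : (Config N → ℂ) →ₗ[ℂ] (Config N → ℂ) where
  toFun g σ := if σ i = false then sgn σ i * g (Function.update σ i true) else 0
  map_add' g h := by
    ext τ
    simp only [Pi.add_apply]
    split_ifs <;> ring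
  map_smul' c g := by
    ext τ
    simp only [Pi.smul_apply, smul_eq_mul, RingHom.id_apply]
    split_ifs <;> ring

lemma fullQ_apply {N : ℕ} (g : Config N → ℂ) (τ : Config N) :
    fullQ N g τ = ∑ i, if τ i = true then sgn τ i * g (Function.update τ i false) else 0 := rfl

lemma fullH_apply {N : ℕ} (i : Fin N) (g : Config N → ℂ) (σ : Config N) :
    fullH i g σ = if σ i = false then sgn σ i * g (Function.update σ i true) else 0 := rfl

lemma sgn_mul_self {N : ℕ} (σ : Config N) (i : Fin N) : sgn σ i * sgn σ i = 1 := by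
  rw [sgn, ← mul_pow]; simp

lemma sgn_update_of_le {N : ℕ} (σ : Config N) {i j : Fin N} (h : j ≤ i) (v : Bool) :
    sgn (Function.update σ i v) j = sgn σ j := by
  unfold sgn
  congr 2
  ext k
  simp only [Finset.mem_filter, Finset.mem_univ, true_and]
  refine and_congr_right fun hk => ?_
  rw [Function.update_of_ne (ne_of_lt (lt_of_lt_of_le hk h))]

lemma sgn_update_true {N : ℕ} (σ : Config N) {i j : Fin N} (h : i < j) (hi : σ i = false) :
    sgn (Function.update σ i true) j = - sgn σ j := by
  unfold sgn
  have : (Finset.univ.filter fun k => k < j ∧ Function.update σ i true k = true)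
      = insert i (Finset.univ.filter fun k => k < j ∧ σ k = true) := by
    ext k
    simp only [Finset.mem_filter, Finset.mem_univ, true_and, Finset.mem_insert]
    by_cases hk : k = i
    · subst hk; simp [h]
    · simp [hk]
  rw [this, Finset.card_insert_of_notMem (by simp [hi]), pow_succ]
  ring

lemma sgn_update_false {N : ℕ} (σ : Config N) {i j : Fin N} (h : i < j) (hi : σ i = true) :
    sgn (Function.update σ i false) j = - sgn σ j := by
  have := sgn_update_true (Function.update σ i false) h (by simp)
  rw [Function.update_idem, ← hi, Function.update_eq_self] at this
  rw [this, neg_neg]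

lemma fullQ_fullQ {N : ℕ} (g : Config N → ℂ) : fullQ N (fullQ N g) = 0 := by
  ext τ
  let F : Fin N → Fin N → ℂ := fun i j =>
    if τ i = true ∧ τ j = true ∧ i ≠ j then sgn τ i * (sgn (Function.update τ i false) j *
      g (Function.update (Function.update τ i false) j false)) else 0
  have h1 : fullQ N (fullQ N g) τ = ∑ i, ∑ j, F i j := by
    simp only [fullQ_apply, F]
    refine Finset.sum_congr rfl fun i _ => ?_
    by_cases hi : τ i = true
    · simp only [hi, if_true, Finset.mul_sum, true_and]
      refine Finset.sum_congr rfl fun j _ => ?_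
      by_cases hij : i = j
      · subst hij; simp
      · rw [Function.update_of_ne (Ne.symm hij)]
        by_cases hj : τ j = true <;> simp [hj, hij]
    · simp [hi]
  have h2 : ∀ i j, F i j = - F j i := by
    intro i j
    by_cases h : τ i = true ∧ τ j = true ∧ i ≠ j
    · have h' : τ j = true ∧ τ i = true ∧ j ≠ i := ⟨h.2.1, h.1, h.2.2.symm⟩
      simp only [F, if_pos h, if_pos h']
      rw [Function.update_comm h.2.2]
      rcases lt_or_gt_of_ne h.2.2 with hlt | hlt
      · rw [sgn_update_false τ hlt h.1, sgn_update_of_le τ hlt.le]; ring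
      · rw [sgn_update_false τ hlt h.2.1, sgn_update_of_le τ hlt.le]; ring
    · have h' : ¬ (τ j = true ∧ τ i = true ∧ j ≠ i) := fun h' => h ⟨h'.2.1, h'.1, h'.2.2.symm⟩
      simp only [F, if_neg h, if_neg h', neg_zero]
  have h3 : ∑ i, ∑ j, F i j = - ∑ i, ∑ j, F i j := by
    conv_lhs => rw [Finset.sum_comm]
    rw [← Finset.sum_neg_distrib]
    refine Finset.sum_congr rfl fun i _ => ?_
    rw [← Finset.sum_neg_distrib]
    exact Finset.sum_congr rfl fun j _ => h2 j i
  rw [h1]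
  simpa using self_eq_neg.mp h3

lemma fullQ_fullH_add {N : ℕ} (i : Fin N) (g : Config N → ℂ) (σ : Config N) :
    fullQ N (fullH i g) σ + fullH i (fullQ N g) σ = g σ := by
  by_cases hi : σ i = true
  · have h1 : fullH i (fullQ N g) σ = 0 := by rw [fullH_apply]; simp [hi]
    rw [h1, add_zero, fullQ_apply, Finset.sum_eq_single i]
    · rw [if_pos hi, fullH_apply, if_pos (by simp), Function.update_idem,
        sgn_update_of_le σ le_rfl, ← mul_assoc, sgn_mul_self, one_mul, ← hi,
        Function.update_eq_self]
    · intro j _ hj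
      rw [fullH_apply, Function.update_of_ne (Ne.symm hj)]
      simp [hi]
    · simp
  · have hi : σ i = false := by simpa using hi
    rw [fullH_apply, if_pos hi, fullQ_apply, fullQ_apply, Finset.mul_sum,
      ← Finset.sum_add_distrib, Finset.sum_eq_single i]
    · simp only [hi, Function.update_self, Function.update_idem, if_true, Bool.false_eq_true,
        if_false, zero_add]
      rw [sgn_update_of_le σ le_rfl, ← mul_assoc, sgn_mul_self, one_mul, ← hi,
        Function.update_eq_self]
    · intro j _ hj
      rw [fullH_apply, Function.update_of_ne (Ne.symm hj), Function.update_of_ne hj, if_pos hi]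
      by_cases h : σ j = true
      · rw [if_pos h, if_pos h, Function.update_comm hj]
        rcases lt_or_gt_of_ne hj with hlt | hlt
        · rw [sgn_update_false σ hlt h, sgn_update_of_le σ hlt.le]; ring
        · rw [sgn_update_true σ hlt hi, sgn_update_of_le σ hlt.le]; ring
      · simp [h]
    · simp

/-- Extension by zero of a state to all configurations. -/
def zeroExt {N : ℕ} (K : Config N → Prop) : AState N K →ₗ[ℂ] (Config N → ℂ) where
  toFun ψ σ := if h : K σ then ψ ⟨σ, h⟩ else 0
  map_add' g h := by
    ext τ
    simp only [Pi.add_apply]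
    split_ifs <;> simp
  map_smul' c g := by
    ext τ
    simp only [Pi.smul_apply, smul_eq_mul, RingHom.id_apply]
    split_ifs <;> simp

/-- Restriction of a function of arbitrary configurations to the allowed ones. -/
def restr {N : ℕ} (K : Config N → Prop) : (Config N → ℂ) →ₗ[ℂ] AState N K :=
  LinearMap.funLeft ℂ ℂ Subtype.val

lemma restr_apply {N : ℕ} (K : Config N → Prop) (g : Config N → ℂ) (σ : {σ // K σ}) :
    restr K g σ = g σ.1 := rfl

lemma zeroExt_of_pos {N : ℕ} {K : Config N → Prop} (ψ : AState N K) {σ : Config N} (h : K σ) :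
    zeroExt K ψ σ = ψ ⟨σ, h⟩ := dif_pos h

lemma zeroExt_of_neg {N : ℕ} {K : Config N → Prop} (ψ : AState N K) {σ : Config N}
    (h : ¬ K σ) : zeroExt K ψ σ = 0 := dif_neg h

lemma restr_zeroExt {N : ℕ} (K : Config N → Prop) (ψ : AState N K) :
    restr K (zeroExt K ψ) = ψ := by
  ext σ
  rw [restr_apply, zeroExt_of_pos ψ σ.2]

lemma zeroExt_restr {N : ℕ} (K : Config N → Prop) (g : Config N → ℂ)
    (hg : ∀ σ, ¬ K σ → g σ = 0) : zeroExt K (restr K g) = g := by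
  ext σ
  by_cases h : K σ
  · rw [zeroExt_of_pos _ h, restr_apply]
  · rw [zeroExt_of_neg _ h, hg σ h]

lemma Qop_eq {N : ℕ} (K : Config N → Prop) (ψ : AState N K) :
    Qop N K (fun _ => True) ψ = restr K (fullQ N (zeroExt K ψ)) := by
  ext τ
  rw [restr_apply, fullQ_apply]
  simp only [Qop, QopA, QmatA, Matrix.mulVecLin_apply, Matrix.mulVec, dotProduct, true_and,
    Finset.sum_mul, one_mul]
  rw [Finset.sum_comm]
  refine Finset.sum_congr rfl fun i _ => ?_
  have key : ∀ σ : {σ // K σ}, (σ.1 i = false ∧ τ.1 = Function.update σ.1 i true) ↔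
      (τ.1 i = true ∧ σ.1 = Function.update τ.1 i false) := by
    intro σ
    constructor
    · rintro ⟨h1, h2⟩
      rw [h2, Function.update_idem, ← h1]
      simp
    · rintro ⟨h1, h2⟩
      rw [h2, Function.update_idem, ← h1]
      simp
  simp only [key]
  by_cases hi : τ.1 i = true
  · simp only [hi, true_and, if_true]
    by_cases hK : K (Function.update τ.1 i false)
    · rw [zeroExt_of_pos _ hK, Finset.sum_eq_single ⟨_, hK⟩]
      · simp [sgn_update_of_le]
      · intro σ _ hσ
        rw [if_neg (fun h => hσ (Subtype.ext h)), zero_mul]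
      · simp
    · rw [zeroExt_of_neg _ hK, mul_zero]
      refine Finset.sum_eq_zero fun σ _ => ?_
      rw [if_neg (fun h : σ.1 = Function.update τ.1 i false => hK (h ▸ σ.2)), zero_mul]
  · simp [hi]

lemma fermions_update_false {N : ℕ} (τ : Config N) (i : Fin N) (hi : τ i = true) :
    fermions (Function.update τ i false) + 1 = fermions τ := by
  unfold fermions
  have : (Finset.univ.filter fun k => τ k = true)
      = insert i (Finset.univ.filter fun k => Function.update τ i false k = true) := by
    ext k
    simp only [Finset.mem_filter, Finset.mem_univ, true_and, Finset.mem_insert]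
    by_cases hk : k = i
    · subst hk; simp [hi]
    · simp [hk]
  rw [this, Finset.card_insert_of_notMem (by simp)]

lemma mem_gradeV {N : ℕ} {K : Config N → Prop} {f : ℕ} {ψ : AState N K} :
    ψ ∈ gradeV N K f ↔ ∀ σ, fermions σ.1 ≠ f → ψ σ = 0 := Iff.rfl

lemma mem_cobounds_iff {N : ℕ} {K : Config N → Prop} {f : ℕ} {ψ : AState N K}
    (hψ : ψ ∈ gradeV N K f) :
    ψ ∈ cobounds N K (fun _ => True) f ↔ ∃ φ, Qop N K (fun _ => True) φ = ψ := by
  constructor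
  · rintro ⟨φ, -, h⟩
    exact ⟨φ, h⟩
  · rintro ⟨φ, rfl⟩
    refine ⟨fun σ => if fermions σ.1 + 1 = f then φ σ else 0, ?_, ?_⟩
    · intro σ hσ
      exact if_neg fun h => hσ (by omega)
    · have hz : ∀ σ, zeroExt K (fun σ => if fermions σ.1 + 1 = f then φ σ else 0) σ =
          if fermions σ + 1 = f then zeroExt K φ σ else 0 := by
        intro σ
        by_cases h : K σ
        · rw [zeroExt_of_pos _ h, zeroExt_of_pos _ h]
        · rw [zeroExt_of_neg _ h, zeroExt_of_neg _ h]; simp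
      ext τ
      by_cases hτ : fermions τ.1 = f
      · rw [Qop_eq, Qop_eq, restr_apply, restr_apply, fullQ_apply, fullQ_apply]
        refine Finset.sum_congr rfl fun i _ => ?_
        by_cases hi : τ.1 i = true
        · rw [if_pos hi, if_pos hi, hz, if_pos]
          rw [fermions_update_false _ _ hi, hτ]
        · simp [hi]
      · rw [hψ τ hτ, Qop_eq, restr_apply, fullQ_apply]
        refine Finset.sum_eq_zero fun i _ => ?_
        by_cases hi : τ.1 i = true
        · rw [if_pos hi, hz, if_neg, mul_zero]
          rw [fermions_update_false _ _ hi]; exact hτ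
        · simp [hi]

/-- If `K` is convex and closed under emptying site `i`, the configurations of `K` at which
site `i` can be toggled within `K` do not contribute to the cohomology. -/
theorem cohDim_eq_of_toggle {N : ℕ} {K K' : Config N → Prop} (i : Fin N)
    (hconv : ∀ σ τ ρ : Config N, K σ → K ρ → (∀ j, σ j = true → τ j = true) →
      (∀ j, τ j = true → ρ j = true) → K τ)
    (hdown : ∀ σ, K σ → K (Function.update σ i false))
    (hK' : ∀ σ, K' σ ↔ K σ ∧ σ i = false ∧ ¬ K (Function.update σ i true)) (f : ℕ) :
    cohDim N K (fun _ => True) f = cohDim N K' (fun _ => True) f := by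
  have hsub : ∀ σ, K' σ → K σ := fun σ h => ((hK' σ).1 h).1
  have hle : ∀ (σ : Config N) (i j : Fin N), Function.update σ i false j = true → σ j = true := by
    intro σ i j
    by_cases h : j = i
    · subst h; simp
    · rw [Function.update_of_ne h]; exact id
  have hup : ∀ (τ : Config N) (j : Fin N), K τ → K' (Function.update τ j false) →
      τ j = true → K' τ := by
    intro τ j hτ hτj hj
    have h1 := (hK' _).1 hτj
    by_cases hij : i = j
    · subst hij
      exfalso
      apply h1.2.2
      rwa [Function.update_idem, ← hj, Function.update_eq_self]
    · refine (hK' τ).2 ⟨hτ, ?_, fun h => h1.2.2 ?_⟩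
      · rw [← h1.2.1, Function.update_of_ne hij]
      · refine hconv _ _ _ h1.1 h ?_ ?_
        · intro k hk
          by_cases hki : k = i
          · subst hki; simp
          · rwa [Function.update_of_ne hki]
        · intro k hk
          by_cases hki : k = i
          · subst hki; simp
          · rw [Function.update_of_ne hki] at hk ⊢
            exact hle _ _ _ hk
  have hH : ∀ ψ : AState N K, ∀ σ, ¬ K σ → fullH i (zeroExt K ψ) σ = 0 := by
    intro ψ σ hσ
    rw [fullH_apply]
    split_ifs with hi
    · rw [zeroExt_of_neg, mul_zero]
      intro h
      apply hσ
      have := hdown _ h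
      rwa [Function.update_idem, ← hi, Function.update_eq_self] at this
    · rfl
  set Q := Qop N K (fun _ => True) with hQ
  set Q' := Qop N K' (fun _ => True) with hQ'
  let H : AState N K → AState N K := fun ψ => restr K (fullH i (zeroExt K ψ))
  have hQH : ∀ ψ, Q (H ψ) = restr K (fullQ N (fullH i (zeroExt K ψ))) := by
    intro ψ
    rw [hQ, Qop_eq, zeroExt_restr _ _ (hH ψ)]
  have hzQ : ∀ ψ σ, K σ → zeroExt K (Q ψ) σ = fullQ N (zeroExt K ψ) σ := by
    intro ψ σ hσ
    rw [zeroExt_of_pos _ hσ, hQ, Qop_eq, restr_apply]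
  have hhom : ∀ ψ (σ : {σ // K σ}), ¬ K' σ.1 → Q (H ψ) σ + H (Q ψ) σ = ψ σ := by
    intro ψ σ hσ
    rw [hQH, restr_apply, ← zeroExt_of_pos ψ σ.2, ← fullQ_fullH_add i (zeroExt K ψ)]
    congr 1
    show fullH i (zeroExt K (Q ψ)) σ.1 = _
    rw [fullH_apply, fullH_apply]
    by_cases hi : σ.1 i = false
    · rw [if_pos hi, if_pos hi, hzQ]
      by_contra h
      exact hσ ((hK' _).2 ⟨σ.2, hi, h⟩)
    · rw [if_neg hi, if_neg hi]
  have hQQH : ∀ ψ, Q (Q (H ψ)) = 0 := by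
    intro ψ
    ext τ
    have h0 := congrFun (fullQ_fullQ (zeroExt K (H ψ))) τ.1
    rw [hQ, Qop_eq, restr_apply, ← hQ, Pi.zero_apply]
    rw [Pi.zero_apply] at h0
    rw [← h0, fullQ_apply, fullQ_apply]
    refine Finset.sum_congr rfl fun j _ => ?_
    split_ifs with hj
    · congr 1
      by_cases hK : K (Function.update τ.1 j false)
      · exact hzQ _ _ hK
      · rw [zeroExt_of_neg _ hK, fullQ_apply]
        symm
        refine Finset.sum_eq_zero fun k _ => ?_
        split_ifs with hk
        · rw [zeroExt_of_neg, mul_zero]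
          exact fun h => hK (hconv _ _ _ h τ.2 (hle _ _) (hle _ _))
        · rfl
    · rfl
  let ι : AState N K' →ₗ[ℂ] AState N K := restr K ∘ₗ zeroExt K'
  have hzι : ∀ w, zeroExt K (ι w) = zeroExt K' w := by
    intro w
    exact zeroExt_restr _ _ fun σ hσ => zeroExt_of_neg _ fun h => hσ (hsub _ h)
  have hιval : ∀ w (σ : {σ // K σ}) (h : K' σ.1), ι w σ = w ⟨σ.1, h⟩ := by
    intro w σ h
    exact zeroExt_of_pos _ h
  have hιzero : ∀ w (σ : {σ // K σ}), ¬ K' σ.1 → ι w σ = 0 := by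
    intro w σ h
    exact zeroExt_of_neg _ h
  have hιinj : ∀ w w', ι w = ι w' → w = w' := by
    intro w w' h
    ext σ
    have := congrFun h ⟨σ.1, hsub _ σ.2⟩
    rwa [hιval _ _ σ.2, hιval _ _ σ.2] at this
  have hQι : ∀ w, Q (ι w) = ι (Q' w) := by
    intro w
    ext τ
    rw [hQ, Qop_eq, restr_apply, hzι]
    by_cases h : K' τ.1
    · rw [hιval _ _ h, hQ', Qop_eq, restr_apply]
    · rw [hιzero _ _ h, fullQ_apply]
      refine Finset.sum_eq_zero fun j _ => ?_
      split_ifs with hj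
      · rw [zeroExt_of_neg, mul_zero]
        exact fun h' => h (hup _ j τ.2 h' hj)
      · rfl
  have hHι : ∀ w, H (ι w) = 0 := by
    intro w
    ext τ
    show fullH i (zeroExt K (ι w)) τ.1 = 0
    rw [hzι, fullH_apply]
    split_ifs with hi
    · rw [zeroExt_of_neg, mul_zero]
      intro h
      simpa using ((hK' _).1 h).2.1
    · rfl
  have hproj : ∀ ψ : AState N K, (∀ σ : {σ // K σ}, ¬ K' σ.1 → ψ σ = 0) →
      ψ = ι (restr K' (zeroExt K ψ)) := by
    intro ψ h
    ext σ
    by_cases hσ : K' σ.1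
    · rw [hιval _ _ hσ, restr_apply, zeroExt_of_pos _ σ.2]
    · rw [hιzero _ _ hσ, h σ hσ]
  have hιgrade : ∀ w, w ∈ gradeV N K' f → ι w ∈ gradeV N K f := by
    intro w hw σ hσ
    by_cases h : K' σ.1
    · rw [hιval _ _ h]; exact hw _ hσ
    · exact hιzero _ _ h
  have hcoc : ∀ w, w ∈ cocycles N K' (fun _ => True) f → ι w ∈ cocycles N K (fun _ => True) f := by
    intro w hw
    refine ⟨?_, hιgrade w hw.2⟩
    show Q (ι w) = 0
    have : Q' w = 0 := hw.1
    rw [hQι, this, map_zero]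
  let φ := ι.restrict hcoc
  let Φ := (Submodule.mkQ ((cobounds N K (fun _ => True) f).comap
    (cocycles N K (fun _ => True) f).subtype)) ∘ₗ φ
  have hsurj : Function.Surjective Φ := by
    intro c
    obtain ⟨⟨z, hz⟩, rfl⟩ := Submodule.mkQ_surjective _ c
    have hQz : Q z = 0 := hz.1
    have hHQz : H (Q z) = 0 := by rw [hQz]; simp [H]
    have hd : z - Q (H z) = ι (restr K' (zeroExt K (z - Q (H z)))) := by
      apply hproj
      intro σ hσ
      have := hhom z σ hσ
      rw [hHQz, Pi.zero_apply, add_zero] at this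
      rw [Pi.sub_apply, this, sub_self]
    have hg : Q (H z) ∈ gradeV N K f := by
      intro σ hσ
      rw [hQH, restr_apply, fullQ_apply]
      refine Finset.sum_eq_zero fun j _ => ?_
      split_ifs with hj
      · rw [fullH_apply]
        split_ifs with hi
        · have : zeroExt K z (Function.update (Function.update σ.1 j false) i true) = 0 := by
            by_cases hK : K (Function.update (Function.update σ.1 j false) i true)
            · rw [zeroExt_of_pos _ hK]
              apply hz.2
              have h1 := fermions_update_false σ.1 j hj
              have h2 := fermions_update_false
                (Function.update (Function.update σ.1 j false) i true) i (by simp)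
              rw [Function.update_idem] at h2
              have h3 : Function.update (Function.update σ.1 j false) i false =
                  Function.update σ.1 j false := by
                conv_rhs => rw [← Function.update_eq_self i (Function.update σ.1 j false), hi]
              rw [h3] at h2
              show fermions (Function.update (Function.update σ.1 j false) i true) ≠ f
              omega
            · exact zeroExt_of_neg _ hK
          rw [this, mul_zero, mul_zero]
        · rw [mul_zero]
      · rfl
    set w := restr K' (zeroExt K (z - Q (H z))) with hw
    have hwg : w ∈ gradeV N K' f := by
      intro σ hσ
      have := (gradeV N K f).sub_mem hz.2 hg ⟨σ.1, hsub _ σ.2⟩ hσ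
      rwa [hd, hιval _ _ σ.2] at this
    have hwQ : Q' w = 0 := by
      apply hιinj
      rw [← hQι, ← hd, map_sub, hQz, hQQH, sub_zero, map_zero]
    refine ⟨⟨w, hwQ, hwg⟩, ?_⟩
    refine (Submodule.Quotient.eq _).2 ?_
    show ι w - z ∈ cobounds N K (fun _ => True) f
    have hiw : ι w - z = - Q (H z) := by rw [← hd]; abel
    rw [hiw]
    refine (cobounds N K (fun _ => True) f).neg_mem ?_
    exact (mem_cobounds_iff hg).2 ⟨H z, rfl⟩
  have hker : LinearMap.ker Φ = (cobounds N K' (fun _ => True) f).comap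
      (cocycles N K' (fun _ => True) f).subtype := by
    ext ⟨w, hw⟩
    have h1 : (⟨w, hw⟩ : cocycles N K' (fun _ => True) f) ∈ LinearMap.ker Φ ↔
        ι w ∈ cobounds N K (fun _ => True) f := by
      rw [LinearMap.mem_ker]
      exact Submodule.Quotient.mk_eq_zero _
    rw [h1, mem_cobounds_iff (hιgrade w hw.2)]
    show _ ↔ w ∈ cobounds N K' (fun _ => True) f
    rw [mem_cobounds_iff hw.2]
    constructor
    · rintro ⟨ψ, hψ⟩
      have hd : ψ - Q (H ψ) = ι (restr K' (zeroExt K (ψ - Q (H ψ)))) := by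
        apply hproj
        intro σ hσ
        have := hhom ψ σ hσ
        rw [hQ, hψ, hHι, Pi.zero_apply, add_zero] at this
        rw [Pi.sub_apply, hQ, this, sub_self]
      refine ⟨restr K' (zeroExt K (ψ - Q (H ψ))), ?_⟩
      apply hιinj
      rw [← hQ', ← hQι, ← hd, map_sub, hQQH, sub_zero, hQ, hψ]
    · rintro ⟨u, hu⟩
      refine ⟨ι u, ?_⟩
      rw [← hQ, hQι, hQ', hu]
  exact ((Submodule.quotEquivOfEq _ _ hker).symm.trans
    (Φ.quotKerEquivOfSurjective hsurj)).symm.finrank_eq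

lemma cohDim_eq_zero_of_forall_not {N : ℕ} {K : Config N → Prop} (hK : ∀ σ, ¬ K σ) (f : ℕ) :
    cohDim N K (fun _ => True) f = 0 := by
  have : IsEmpty {σ // K σ} := ⟨fun σ => hK _ σ.2⟩
  exact Module.finrank_zero_of_subsingleton

lemma cohDim_of_forall_iff_eq {N : ℕ} {K : Config N → Prop} (σ₀ : Config N)
    (hK : ∀ σ, K σ ↔ σ = σ₀) (f : ℕ) :
    cohDim N K (fun _ => True) f = if f = fermions σ₀ then 1 else 0 := by
  have hQ : ∀ ψ, Qop N K (fun _ => True) ψ = 0 := by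
    intro ψ
    ext τ
    rw [Qop_eq, restr_apply, fullQ_apply]
    refine Finset.sum_eq_zero fun i _ => ?_
    split_ifs with hi
    · rw [zeroExt_of_neg, mul_zero]
      rw [hK, ← (hK _).1 τ.2]
      intro h
      have := congrFun h i
      simp [hi] at this
    · rfl
  have hcob : (cobounds N K (fun _ => True) f).comap (cocycles N K (fun _ => True) f).subtype
      = ⊥ := by
    rw [eq_bot_iff]
    rintro ⟨z, hz⟩ ⟨φ, -, h⟩
    rw [hQ] at h
    exact Subtype.ext h.symm
  have e : CohSpace N K (fun _ => True) f ≃ₗ[ℂ] cocycles N K (fun _ => True) f :=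
    Submodule.quotEquivOfEqBot _ hcob
  have hu : Unique {σ // K σ} :=
    ⟨⟨⟨σ₀, (hK _).2 rfl⟩⟩, fun σ => Subtype.ext ((hK _).1 σ.2)⟩
  rw [cohDim, e.finrank_eq]
  split_ifs with hf
  · have : cocycles N K (fun _ => True) f = ⊤ := by
      rw [eq_top_iff]
      refine fun ψ _ => ⟨hQ ψ, fun σ hσ => ?_⟩
      rw [(hK _).1 σ.2] at hσ
      exact absurd hf.symm hσ
    rw [this, finrank_top, Module.finrank_fintype_fun_eq_card, Fintype.card_unique]
  · have : cocycles N K (fun _ => True) f = ⊥ := by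
      rw [eq_bot_iff]
      refine fun ψ hψ => ?_
      ext σ
      refine hψ.2 σ ?_
      rw [(hK _).1 σ.2]
      exact fun h => hf h.symm
    rw [this, finrank_bot]

lemma extc_of_lt {N : ℕ} (σ : Config N) {t : ℕ} (h : t < N) : extc σ t = σ ⟨t, h⟩ := dif_pos h

lemma lt_of_extc {N : ℕ} {σ : Config N} {t : ℕ} (h : extc σ t = true) : t < N := by
  by_contra h'
  simp [extc, h'] at h

lemma extc_update {N : ℕ} (σ : Config N) (i : Fin N) (v : Bool) (t : ℕ) :
    extc (Function.update σ i v) t = if t = i.1 then v else extc σ t := by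
  by_cases ht : t < N
  · rw [extc_of_lt _ ht, extc_of_lt _ ht]
    simp [Function.update_apply, Fin.ext_iff]
  · have : t ≠ i.1 := fun h => ht (h ▸ i.2)
    simp [extc, ht, this]

lemma extc_le {N : ℕ} {σ τ : Config N} (h : ∀ j, σ j = true → τ j = true) (t : ℕ)
    (ht : extc σ t = true) : extc τ t = true := by
  have hN := lt_of_extc ht
  rw [extc_of_lt _ hN] at ht ⊢
  exact h _ ht

/-- Configurations whose first `s` sites are occupied exactly off `Z`, subject to `R`. -/
def Pinned (N s : ℕ) (Z : Finset ℕ) (R : Config N → Prop) (σ : Config N) : Prop :=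
  (∀ t < s, extc σ t = true ↔ t ∉ Z) ∧ R σ

/-- A condition on configurations inherited under removal of particles. -/
def RemovalClosed {N : ℕ} (R : Config N → Prop) : Prop :=
  ∀ σ τ : Config N, (∀ t, extc σ t = true → extc τ t = true) → R τ → R σ

/-- `τ` is obtained from `σ` by occupying the empty site `s`. -/
def AddsAt {N : ℕ} (s : ℕ) (σ τ : Config N) : Prop :=
  extc σ s = false ∧ ∀ t, extc τ t = true ↔ extc σ t = true ∨ t = s

lemma pinned_congr {N s : ℕ} {Z : Finset ℕ} {R R' : Config N → Prop}
    (h : ∀ σ : Config N, (∀ t < s, extc σ t = true ↔ t ∉ Z) → (R σ ↔ R' σ)) :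
    Pinned N s Z R = Pinned N s Z R' := by
  ext σ
  exact and_congr_right fun hσ => h σ hσ

lemma cohDim_pinned_toggle {N s : ℕ} {Z : Finset ℕ} {R : Config N → Prop} {K' : Config N → Prop}
    (hs : s < N) (hR : RemovalClosed R)
    (hK' : ∀ σ τ, AddsAt s σ τ → (K' σ ↔ Pinned N s Z R σ ∧ ¬ R τ))
    (hK's : ∀ σ, K' σ → extc σ s = false) (f : ℕ) :
    cohDim N (Pinned N s Z R) (fun _ => True) f = cohDim N K' (fun _ => True) f := by
  refine cohDim_eq_of_toggle ⟨s, hs⟩ ?_ ?_ ?_ f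
  · intro σ τ ρ hσ hρ h1 h2
    refine ⟨fun t ht => ⟨fun h => ?_, fun h => ?_⟩, hR _ _ (extc_le h2) hρ.2⟩
    · exact (hρ.1 t ht).1 (extc_le h2 t h)
    · exact extc_le h1 t ((hσ.1 t ht).2 h)
  · intro σ hσ
    refine ⟨fun t ht => ?_, hR _ _ (fun t => ?_) hσ.2⟩
    · rw [extc_update, if_neg (ne_of_lt ht)]
      exact hσ.1 t ht
    · rw [extc_update]
      split_ifs <;> simp
  · intro σ
    have hadd : σ ⟨s, hs⟩ = false → AddsAt s σ (Function.update σ ⟨s, hs⟩ true) := by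
      intro h
      refine ⟨by rwa [extc_of_lt _ hs], fun t => ?_⟩
      rw [extc_update]
      split_ifs with ht <;> simp [ht]
    have hpin : Pinned N s Z R (Function.update σ ⟨s, hs⟩ true) ↔
        (∀ t < s, extc σ t = true ↔ t ∉ Z) ∧ R (Function.update σ ⟨s, hs⟩ true) := by
      refine and_congr_left fun _ => forall₂_congr fun t ht => ?_
      rw [extc_update, if_neg (ne_of_lt ht)]
    rw [hpin]
    constructor
    · intro h
      have h0 := hK's σ h
      rw [extc_of_lt _ hs] at h0
      have h1 := (hK' _ _ (hadd h0)).1 h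
      exact ⟨h1.1, h0, fun h2 => h1.2 h2.2⟩
    · rintro ⟨h1, h2, h3⟩
      exact (hK' _ _ (hadd h2)).2 ⟨h1, fun h => h3 ⟨h1.1, h⟩⟩

/-- Toggling the first unpinned site `s` leaves the configurations with `s` empty and the
sites strictly between `s` and `s'` occupied. -/
lemma cohDim_pinned_step {N s s' : ℕ} {Z : Finset ℕ} {R R' : Config N → Prop}
    (hs : s < N) (hss' : s < s') (hZ : ∀ t ∈ Z, t < s) (hR : RemovalClosed R)
    (hR' : ∀ σ τ, AddsAt s σ τ →
      (R σ ∧ ¬ R τ ↔ (∀ t, s < t → t < s' → extc σ t = true) ∧ R' σ)) (f : ℕ) :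
    cohDim N (Pinned N s Z R) (fun _ => True) f =
      cohDim N (Pinned N s' (insert s Z) R') (fun _ => True) f := by
  refine cohDim_pinned_toggle hs hR (fun σ τ h => ?_) (fun σ h => ?_) f
  · unfold Pinned
    rw [and_assoc, hR' σ τ h, ← and_assoc]
    refine and_congr_left fun _ => ⟨fun hp => ⟨fun t ht => ?_, fun t h1 h2 => ?_⟩, ?_⟩
    · rw [hp t (ht.trans hss'), Finset.mem_insert]
      simp [ne_of_lt ht]
    · rw [hp t h2, Finset.mem_insert]
      rintro (h3 | h3)
      · omega
      · have := hZ t h3; omega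
    · rintro ⟨h1, h2⟩ t ht
      rw [Finset.mem_insert]
      rcases lt_trichotomy t s with h3 | h3 | h3
      · rw [h1 t h3]
        simp [ne_of_lt h3]
      · subst h3; simp [h.1]
      · have : t ∉ Z := fun h4 => by have := hZ t h4; omega
        simp [h2 t h3 ht, this, ne_of_gt h3]
  · have := h.1 s hss'
    simpa using this

lemma cohDim_pinned_cone {N s : ℕ} {Z : Finset ℕ} {R : Config N → Prop}
    (hs : s < N) (hR : RemovalClosed R) (hadd : ∀ σ τ, AddsAt s σ τ → R σ → R τ) (f : ℕ) :
    cohDim N (Pinned N s Z R) (fun _ => True) f = 0 := by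
  rw [cohDim_pinned_toggle (K' := fun _ => False) hs hR]
  · exact cohDim_eq_zero_of_forall_not (fun _ => id) f
  · intro σ τ h
    simpa using fun h1 => hadd σ τ h h1.2
  · exact fun _ h => h.elim

lemma cohDim_pinned_all {N : ℕ} {Z : Finset ℕ} (hZ : ∀ t ∈ Z, t < N) (f : ℕ) :
    cohDim N (Pinned N N Z fun _ => True) (fun _ => True) f =
      if f + Z.card = N then 1 else 0 := by
  rw [cohDim_of_forall_iff_eq (fun i => decide (i.1 ∉ Z))]
  · have : fermions (fun i : Fin N => decide (i.1 ∉ Z)) + Z.card = N := by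
      have h1 : fermions (fun i : Fin N => decide (i.1 ∉ Z)) = (Finset.range N \ Z).card := by
        unfold fermions
        rw [← Finset.card_map Fin.valEmbedding]
        congr 1
        ext t
        simp only [Finset.mem_map, Finset.mem_filter, Finset.mem_univ, true_and,
          decide_eq_true_eq, Fin.valEmbedding_apply, Finset.mem_sdiff, Finset.mem_range]
        constructor
        · rintro ⟨i, hi, rfl⟩
          exact ⟨i.2, hi⟩
        · rintro ⟨h1, h2⟩
          exact ⟨⟨t, h1⟩, h2, rfl⟩
      have h2 : Z ⊆ Finset.range N := fun t ht => Finset.mem_range.2 (hZ t ht)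
      rw [h1, Finset.card_sdiff_add_card_eq_card h2, Finset.card_range]
    congr 1
    apply propext
    omega
  · intro σ
    unfold Pinned
    constructor
    · rintro ⟨h, -⟩
      ext i
      have := h i.1 i.2
      rw [extc_of_lt _ i.2] at this
      rw [Bool.eq_iff_iff, this]
      simp
    · rintro rfl
      refine ⟨fun t ht => ?_, trivial⟩
      rw [extc_of_lt _ ht]
      simp

lemma removalClosed_true {N : ℕ} : RemovalClosed fun _ : Config N => True := fun _ _ _ _ => trivial

/-- The sites from `e` on are not all occupied. -/
def EndGap (N e : ℕ) (σ : Config N) : Prop := ¬ ∀ t, e ≤ t → t < N → extc σ t = true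

lemma removalClosed_endGap {N e : ℕ} : RemovalClosed (EndGap N e) :=
  fun _ _ h hτ hσ => hτ fun t h1 h2 => h t (hσ t h1 h2)

lemma cohDim_pinned_endGap {N s e : ℕ} {Z : Finset ℕ} (hs : s ≤ N) (he : e < N)
    (hZ : ∀ t ∈ Z, t < s) (hZe : ∀ t ∈ Z, t < e) (f : ℕ) :
    cohDim N (Pinned N s Z (EndGap N e)) (fun _ => True) f =
      if e ≤ s ∧ s < N ∧ f + Z.card + 1 = N then 1 else 0 := by
  by_cases hes : e ≤ s
  · have hcongr : Pinned N s Z (EndGap N e) = Pinned N s Z (EndGap N s) := by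
      refine pinned_congr fun σ hσ => not_congr ⟨fun h t h1 h2 => h t (hes.trans h1) h2,
        fun h t h1 h2 => ?_⟩
      by_cases ht : s ≤ t
      · exact h t ht h2
      · exact (hσ t (by omega)).2 fun h3 => by have := hZe t h3; omega
    rw [hcongr]
    by_cases hsN : s < N
    · rw [cohDim_pinned_step (R' := fun _ => True) hsN hsN hZ removalClosed_endGap,
        cohDim_pinned_all]
      · rw [Finset.card_insert_of_notMem fun h => lt_irrefl s (hZ s h)]
        congr 1
        apply propext
        omega
      · intro t ht
        rcases Finset.mem_insert.1 ht with rfl | ht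
        · exact hsN
        · exact (hZ t ht).trans hsN
      · intro σ τ h
        unfold EndGap
        constructor
        · rintro ⟨-, h2⟩
          refine ⟨fun t h3 h4 => ?_, trivial⟩
          rcases (h.2 t).1 (not_not.1 h2 t h3.le h4) with h5 | h5
          · exact h5
          · omega
        · rintro ⟨h1, -⟩
          refine ⟨fun h2 => ?_, not_not.2 fun t h3 h4 => (h.2 t).2 ?_⟩
          · have := h2 s le_rfl hsN
            rw [h.1] at this
            simp at this
          · by_cases hts : t = s
            · exact Or.inr hts
            · exact Or.inl (h1 t (by omega) h4)
    · rw [if_neg (by omega)]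
      exact cohDim_eq_zero_of_forall_not (fun σ hσ => hσ.2 fun t h1 h2 => by omega) f
  · rw [if_neg (by omega)]
    refine cohDim_pinned_cone (by omega) removalClosed_endGap (fun σ τ h hσ hτ => ?_) f
    refine hσ fun t h1 h2 => ?_
    rcases (h.2 t).1 (hτ t h1 h2) with h3 | h3
    · exact h3
    · omega

/-- The exclusion conditions on the sites from `s` on: no cluster longer than `ℓ`, the cluster
at `s` not longer than `a`, and the cluster at the last site not longer than `b`. -/
def TailOK (N ℓ b s a : ℕ) (σ : Config N) : Prop :=
  (∀ j, s ≤ j → ¬ ∀ k ≤ ℓ, extc σ (j + k) = true) ∧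
  (¬ ∀ k ≤ a, extc σ (s + k) = true) ∧
  (¬ ∀ k ≤ b, extc σ (N - 1 - k) = true)

lemma removalClosed_tailOK {N ℓ b s a : ℕ} : RemovalClosed (TailOK N ℓ b s a) :=
  fun _ _ h hτ => ⟨fun j hj h' => hτ.1 j hj fun k hk => h _ (h' k hk),
    fun h' => hτ.2.1 fun k hk => h _ (h' k hk), fun h' => hτ.2.2 fun k hk => h _ (h' k hk)⟩

lemma openOK_eq_pinned {N ℓ a b : ℕ} (ha : a + 1 ≤ N) (hb : b + 1 ≤ N) :
    OpenOK N ℓ a b = Pinned N 0 ∅ (TailOK N ℓ b 0 a) := by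
  ext σ
  simp [OpenOK, Pinned, TailOK, ha, hb]

lemma cohDim_pinned_tailOK_step {N ℓ b s a : ℕ} {Z : Finset ℕ} (hN : s + ℓ + 2 ≤ N)
    (ha : a ≤ ℓ) (hb : b ≤ ℓ) (hZ : ∀ t ∈ Z, t < s) (f : ℕ) :
    cohDim N (Pinned N s Z (TailOK N ℓ b s a)) (fun _ => True) f =
      cohDim N (Pinned N (s + a + 1) (insert s Z) (TailOK N ℓ b (s + a + 1) (ℓ - a)))
        (fun _ => True) f := by
  refine cohDim_pinned_step (by omega) (by omega) hZ removalClosed_tailOK (fun σ τ h => ?_) f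
  have hs : ¬ extc σ s = true := by simp [h.1]
  have hne : ∀ t, t ≠ s → (extc τ t = true ↔ extc σ t = true) := fun t ht => by
    rw [h.2 t]; simp [ht]
  constructor
  · rintro ⟨h1, h2⟩
    have hrun : ∀ t, s < t → t < s + a + 1 → extc σ t = true := by
      by_contra hcon
      push Not at hcon
      obtain ⟨t, ht1, ht2, ht3⟩ := hcon
      refine h2 ⟨fun j hj h' => ?_, fun h' => ?_, fun h' => h1.2.2 fun k hk => ?_⟩
      · by_cases hjs : j = s
        · have := h' (t - s) (by omega)
          rw [hjs, Nat.add_sub_cancel' ht1.le, hne t (by omega)] at this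
          exact ht3 this
        · exact h1.1 j hj fun k hk => (hne _ (by omega)).1 (h' k hk)
      · have := h' (t - s) (by omega)
        rw [Nat.add_sub_cancel' ht1.le, hne t (by omega)] at this
        exact ht3 this
      · exact (hne _ (by omega)).1 (h' k hk)
    refine ⟨hrun, fun j hj => h1.1 j (by omega), fun h' => ?_, h1.2.2⟩
    refine h1.1 (s + 1) (by omega) fun k hk => ?_
    by_cases hka : k < a
    · exact hrun _ (by omega) (by omega)
    · have := h' (k - a) (by omega)
      rwa [show s + a + 1 + (k - a) = s + 1 + k by omega] at this
  · rintro ⟨hrun, h1, h2, h3⟩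
    refine ⟨⟨fun j hj h' => ?_, fun h' => hs (h' 0 (by omega)), h3⟩, fun h' => h'.2.1 fun k hk => ?_⟩
    · by_cases hjs : j = s
      · subst hjs; exact hs (h' 0 (by omega))
      · by_cases hja : s + a + 1 ≤ j
        · exact h1 j hja h'
        · refine h2 fun k hk => ?_
          by_cases hkj : s + a + 1 + k < j
          · exact hrun _ (by omega) (by omega)
          · have := h' (s + a + 1 + k - j) (by omega)
            rwa [Nat.add_sub_cancel' (by omega)] at this
    · by_cases hk0 : k = 0
      · subst hk0; exact (h.2 _).2 (Or.inr rfl)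
      · exact (h.2 _).2 (Or.inl (hrun _ (by omega) (by omega)))

lemma forall_extc_suffix_iff {N b : ℕ} (hb : b < N) (σ : Config N) :
    (∀ k ≤ b, extc σ (N - 1 - k) = true) ↔
      ∀ t, N - 1 - b ≤ t → t < N → extc σ t = true := by
  constructor
  · intro h t h1 h2
    have := h (N - 1 - t) (by omega)
    rwa [show N - 1 - (N - 1 - t) = t by omega] at this
  · intro h k hk
    exact h _ (by omega) (by omega)

/-- The cohomology of the last stage, in which at most `ℓ + 1` sites are not pinned. -/
lemma cohDim_pinned_tailOK_end {N ℓ b s a : ℕ} {Z : Finset ℕ} (hN : N ≤ s + ℓ + 1)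
    (ha : s + a + 1 ≤ N) (hb : b < N) (hZ : ∀ t ∈ Z, t < s) (f : ℕ) :
    cohDim N (Pinned N s Z (TailOK N ℓ b s a)) (fun _ => True) f =
      if (N ≤ s + b + 1 ∧ s + a + 1 = N ∧ f + Z.card + 1 = N) ∨
        (s + b + 1 < N ∧ N ≤ s + a + b + 2 ∧ s + a + 1 < N ∧ f + Z.card + 2 = N)
      then 1 else 0 := by
  have hcard : (insert s Z).card = Z.card + 1 :=
    Finset.card_insert_of_notMem fun h => lt_irrefl s (hZ s h)
  have hZ' : ∀ t ∈ insert s Z, t < s + 1 := by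
    intro t ht
    rcases Finset.mem_insert.1 ht with rfl | ht
    · omega
    · have := hZ t ht; omega
  have hlong : ∀ (σ : Config N) j, s ≤ j → (∀ k ≤ ℓ, extc σ (j + k) = true) →
      ∀ k ≤ a, extc σ (s + k) = true := by
    intro σ j hj h k hk
    have h1 := lt_of_extc (h ℓ le_rfl)
    have h2 : j = s := by omega
    subst h2
    exact h k (by omega)
  have hrunτ : ∀ σ τ : Config N, AddsAt s σ τ → ((∀ k ≤ a, extc τ (s + k) = true) ↔
      ∀ t, s < t → t < s + a + 1 → extc σ t = true) := by
    intro σ τ h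
    constructor
    · intro h1 t h2 h3
      have := h1 (t - s) (by omega)
      rw [Nat.add_sub_cancel' h2.le, h.2] at this
      exact this.resolve_right (by omega)
    · intro h1 k hk
      by_cases hk0 : k = 0
      · subst hk0; exact (h.2 _).2 (Or.inr rfl)
      · exact (h.2 _).2 (Or.inl (h1 _ (by omega) (by omega)))
  by_cases hbs : N ≤ s + b + 1
  · rw [cohDim_pinned_step (R' := fun _ => True) (s' := s + a + 1) (by omega) (by omega) hZ
      removalClosed_tailOK]
    · by_cases has : s + a + 1 = N
      · rw [has, cohDim_pinned_all fun t ht => by have := hZ' t ht; omega, hcard]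
        congr 1
        apply propext
        omega
      · rw [if_neg (by omega)]
        exact cohDim_pinned_cone (by omega) removalClosed_true (fun _ _ _ h => h) f
    · intro σ τ h
      have hs : ¬ extc σ s = true := by simp [h.1]
      have hsuf : ∀ ρ : Config N, (∀ k ≤ b, extc ρ (N - 1 - k) = true) →
          ∀ k ≤ a, extc ρ (s + k) = true := by
        intro ρ h1 k hk
        exact (forall_extc_suffix_iff hb ρ).1 h1 _ (by omega) (by omega)
      rw [← hrunτ σ τ h, and_true]
      constructor
      · rintro ⟨-, h2⟩
        by_contra h3
        exact h2 ⟨fun j hj h4 => h3 (hlong τ j hj h4), h3, fun h4 => h3 (hsuf τ h4)⟩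
      · intro h1
        have h0 : ¬ ∀ k ≤ a, extc σ (s + k) = true := fun h2 => hs (h2 0 (by omega))
        exact ⟨⟨fun j hj h4 => h0 (hlong σ j hj h4), h0, fun h4 => h0 (hsuf σ h4)⟩,
          fun h2 => h2.2.1 h1⟩
  · rw [cohDim_pinned_step (R' := EndGap N (N - 1 - b)) (s' := s + a + 1) (by omega) (by omega) hZ
      removalClosed_tailOK]
    · rw [cohDim_pinned_endGap ha (by omega) (fun t ht => by have := hZ' t ht; omega)
        (fun t ht => by have := hZ' t ht; omega), hcard]
      congr 1
      apply propext
      omega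
    · intro σ τ h
      have hs : ¬ extc σ s = true := by simp [h.1]
      have hgap : EndGap N (N - 1 - b) τ ↔ EndGap N (N - 1 - b) σ := by
        refine not_congr (forall₃_congr fun t h1 h2 => ?_)
        rw [h.2 t]
        have : t ≠ s := by omega
        simp [this]
      have htail : ∀ ρ : Config N, TailOK N ℓ b s a ρ ↔
          (¬ ∀ k ≤ a, extc ρ (s + k) = true) ∧ EndGap N (N - 1 - b) ρ := by
        intro ρ
        rw [TailOK, forall_extc_suffix_iff hb ρ]
        exact ⟨fun h1 => h1.2, fun h1 => ⟨fun j hj h4 => h1.1 (hlong ρ j hj h4), h1⟩⟩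
      have h0 : ¬ ∀ k ≤ a, extc σ (s + k) = true := fun h2 => hs (h2 0 (by omega))
      rw [htail, htail, hgap, ← hrunτ σ τ h]
      tauto

/-- Successive toggles pin `n` periods of length `ℓ + 2`, each with two empty sites. -/
lemma exists_cohDim_openOK_eq {N ℓ a b : ℕ} (ha : a ≤ ℓ) (hb : b ≤ ℓ) (hN : ℓ + 1 ≤ N) (n : ℕ)
    (hn : n * (ℓ + 2) + a + 1 ≤ N) :
    ∃ Z : Finset ℕ, (∀ t ∈ Z, t < n * (ℓ + 2)) ∧ Z.card = 2 * n ∧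
      ∀ f, cohDim N (OpenOK N ℓ a b) (fun _ => True) f =
        cohDim N (Pinned N (n * (ℓ + 2)) Z (TailOK N ℓ b (n * (ℓ + 2)) a)) (fun _ => True) f := by
  induction n with
  | zero =>
    refine ⟨∅, by simp, by simp, fun f => ?_⟩
    rw [zero_mul, openOK_eq_pinned (by omega) (by omega)]
  | succ n ih =>
    rw [Nat.succ_mul] at hn
    obtain ⟨Z, hZ, hcard, h⟩ := ih (by omega)
    rw [Nat.succ_mul]
    set s := n * (ℓ + 2)
    have hZ₁ : ∀ t ∈ insert s Z, t < s + a + 1 := by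
      intro t ht
      rcases Finset.mem_insert.1 ht with rfl | ht
      · omega
      · have := hZ t ht; omega
    refine ⟨insert (s + a + 1) (insert s Z), ?_, ?_, fun f => ?_⟩
    · intro t ht
      rcases Finset.mem_insert.1 ht with rfl | ht
      · omega
      · have := hZ₁ t ht; omega
    · rw [Finset.card_insert_of_notMem fun h => lt_irrefl _ (hZ₁ _ h),
        Finset.card_insert_of_notMem fun h => lt_irrefl _ (hZ _ h), hcard]
      ring
    · rw [h f, cohDim_pinned_tailOK_step (by omega) ha hb hZ,
        cohDim_pinned_tailOK_step (by omega) (by omega) hb hZ₁]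
      rw [show s + a + 1 + (ℓ - a) + 1 = s + (ℓ + 2) by omega, show ℓ - (ℓ - a) = a by omega]

/-- The cohomology of the open chain with special boundary conditions, in all cases. -/
theorem cohDim_openOK {ℓ n p N a b : ℕ} (hn : 1 ≤ n) (hp : p ≤ ℓ + 1) (ha : a ≤ ℓ) (hb : b ≤ ℓ)
    (hN : N = n * (ℓ + 2) + p + 1) (f : ℕ) :
    cohDim N (OpenOK N ℓ a b) (fun _ => True) f =
      if (p ≤ a ∧ p ≤ b ∧ a + b ≤ ℓ + p ∧ f = n * ℓ + p) ∨
        (a < p ∧ b < p ∧ p ≤ a + b + 1 ∧ f + 1 = n * ℓ + p) then 1 else 0 := by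
  have hper : n * (ℓ + 2) = n * ℓ + 2 * n := by ring
  have hbig : ℓ + 2 ≤ n * (ℓ + 2) := Nat.le_mul_of_pos_left _ hn
  have step : ∀ (s : ℕ) (Z : Finset ℕ), s + ℓ + 2 ≤ N → N ≤ s + a + ℓ + 2 → (∀ t ∈ Z, t < s) →
      cohDim N (Pinned N s Z (TailOK N ℓ b s a)) (fun _ => True) f =
      if (N ≤ s + a + b + 2 ∧ s + ℓ + 2 = N ∧ f + Z.card + 2 = N) ∨
        (s + a + b + 2 < N ∧ N ≤ s + ℓ + b + 3 ∧ s + ℓ + 2 < N ∧ f + Z.card + 3 = N)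
      then 1 else 0 := by
    intro s Z h1 h2 hZ
    rw [cohDim_pinned_tailOK_step h1 ha hb hZ, cohDim_pinned_tailOK_end (by omega) (by omega)
      (by omega), Finset.card_insert_of_notMem fun h => lt_irrefl _ (hZ _ h)]
    · congr 1
      apply propext
      omega
    · intro t ht
      rcases Finset.mem_insert.1 ht with rfl | ht
      · omega
      · have := hZ t ht; omega
  by_cases hap : a ≤ p
  · obtain ⟨Z, hZ, hcard, h⟩ := exists_cohDim_openOK_eq (N := N) ha hb (by omega) n (by omega)
    rw [h f]
    by_cases hpl : p ≤ ℓ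
    · rw [cohDim_pinned_tailOK_end (by omega) (by omega) (by omega) hZ, hcard]
      congr 1
      apply propext
      omega
    · rw [step _ _ (by omega) (by omega) hZ, hcard]
      congr 1
      apply propext
      omega
  · obtain ⟨m, rfl⟩ : ∃ m, n = m + 1 := ⟨n - 1, by omega⟩
    rw [Nat.succ_mul] at hN hbig hper
    obtain ⟨Z, hZ, hcard, h⟩ := exists_cohDim_openOK_eq (N := N) ha hb (by omega) m (by omega)
    rw [h f, step _ _ (by omega) (by omega) hZ, hcard]
    congr 1
    apply propext
    omega

/-- Ground states of the open chain with special boundary conditions `s = (c₁, cN)`,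
`N = n(ℓ+2)+p+1`, `n ≥ 1`, `0 ≤ p ≤ ℓ+1`:
(i) if `0 ≤ p ≤ ℓ`, `c₁, cN ≥ p` and `c₁ + cN ≤ ℓ + p`, the cohomology is
one-dimensional and concentrated at fermion number `nℓ+p`;
(ii) if `1 ≤ p`, `c₁, cN < p` and `c₁ + cN ≥ p - 1`, it is one-dimensional and
concentrated at fermion number `nℓ+p-1`;
otherwise it vanishes. -/
theorem ground_states_special_chain (ℓ n p N c₁ cN : ℕ) (hℓ : 1 ≤ ℓ) (hn : 1 ≤ n)
    (hp : p ≤ ℓ + 1) (hc₁ : c₁ ≤ ℓ) (hcN : cN ≤ ℓ)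
    (hN : N = n * (ℓ + 2) + p + 1) :
    ((p ≤ ℓ ∧ p ≤ c₁ ∧ p ≤ cN ∧ c₁ + cN ≤ ℓ + p) →
      ∀ f, cohDim N (OpenOK N ℓ c₁ cN) (fun _ => True) f =
        if f = n * ℓ + p then 1 else 0) ∧
    ((1 ≤ p ∧ c₁ < p ∧ cN < p ∧ p - 1 ≤ c₁ + cN) →
      ∀ f, cohDim N (OpenOK N ℓ c₁ cN) (fun _ => True) f =
        if f = n * ℓ + p - 1 then 1 else 0) ∧
    (¬ (p ≤ ℓ ∧ p ≤ c₁ ∧ p ≤ cN ∧ c₁ + cN ≤ ℓ + p) →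
      ¬ (1 ≤ p ∧ c₁ < p ∧ cN < p ∧ p - 1 ≤ c₁ + cN) →
      ∀ f, cohDim N (OpenOK N ℓ c₁ cN) (fun _ => True) f = 0) := by
  refine ⟨fun h f => ?_, fun h f => ?_, fun h h' f => ?_⟩ <;>
    rw [cohDim_openOK hn hp hc₁ hcN hN]
  · congr 1
    apply propext
    omega
  · congr 1
    apply propext
    omega
  · exact if_neg (by omega)

end
end

section
/- Let ℓ ≥ 1 and ℓ+3 ≤ N ≤ 2ℓ+2. For the M_ℓ model on the closed chain of N sites with periodic boundary conditions, dim H_Q^f = 1 for f = N−3 and dim H_Q^f = 0 for every other f. -/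
attribute [local instance 10] Classical.propDecidable

noncomputable section

namespace Config

variable {N : ℕ}

/-- The supercharge on functions on all configurations, including the forbidden ones. -/
def diff : (Config N → ℂ) →ₗ[ℂ] (Config N → ℂ) where
  toFun ψ τ := ∑ i, if τ i = true then sgn τ i * ψ (Function.update τ i false) else 0
  map_add' ψ φ := by
    ext τ
    simp only [Pi.add_apply, ← Finset.sum_add_distrib]
    refine Finset.sum_congr rfl fun i _ => ?_
    split_ifs <;> ring
  map_smul' c ψ := by
    ext τ
    simp only [Pi.smul_apply, smul_eq_mul, RingHom.id_apply, Finset.mul_sum]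
    refine Finset.sum_congr rfl fun i _ => ?_
    split_ifs <;> ring

/-- Annihilation of a particle at site `i`, on functions on all configurations. -/
def ann (i : Fin N) (ψ : Config N → ℂ) : Config N → ℂ := fun σ =>
  if σ i = false then sgn σ i * ψ (Function.update σ i true) else 0

/-- The component of fermion number `f`. -/
def gradePart (f : ℕ) (ψ : Config N → ℂ) : Config N → ℂ := fun σ =>
  if fermions σ = f then ψ σ else 0

/-- Stability under removal of particles. -/
def Down (P : Config N → Prop) : Prop :=
  ∀ σ i, P σ → P (Function.update σ i false)

lemma diff_apply (ψ : Config N → ℂ) (τ : Config N) :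
    diff ψ τ = ∑ i, if τ i = true then sgn τ i * ψ (Function.update τ i false) else 0 := rfl

lemma sgn_mul_self (σ : Config N) (i : Fin N) : sgn σ i * sgn σ i = 1 := by
  unfold sgn
  rw [← mul_pow]
  simp

lemma sgn_update_of_le (σ : Config N) {i j : Fin N} (h : i ≤ j) (b : Bool) :
    sgn (Function.update σ j b) i = sgn σ i := by
  unfold sgn
  congr 2
  ext k
  simp only [Finset.mem_filter, Finset.mem_univ, true_and]
  refine and_congr_right fun hk => ?_
  rw [Function.update_of_ne (hk.trans_le h).ne]

lemma sgn_update_true (σ : Config N) {i j : Fin N} (h : j < i) (hj : σ j = false) :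
    sgn (Function.update σ j true) i = -sgn σ i := by
  unfold sgn
  have : (Finset.univ.filter fun k => k < i ∧ Function.update σ j true k = true) =
      insert j (Finset.univ.filter fun k => k < i ∧ σ k = true) := by
    ext k
    by_cases hk : k = j
    · subst hk; simp [h]
    · simp [hk]
  rw [this, Finset.card_insert_of_notMem (by simp [hj]), pow_succ]
  ring

lemma update_false_true {σ : Config N} {i : Fin N} (h : σ i = true) :
    Function.update (Function.update σ i false) i true = σ := by
  rw [Function.update_idem, ← h, Function.update_eq_self]

lemma update_true_false {σ : Config N} {i : Fin N} (h : σ i = false) :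
    Function.update (Function.update σ i true) i false = σ := by
  rw [Function.update_idem, ← h, Function.update_eq_self]

lemma sgn_update_false (σ : Config N) {i j : Fin N} (h : j < i) (hj : σ j = true) :
    sgn (Function.update σ j false) i = -sgn σ i := by
  have := sgn_update_true (Function.update σ j false) h (by simp)
  rw [update_false_true hj] at this
  rw [this, neg_neg]

lemma diff_ann_add_ann_diff (i : Fin N) (ψ : Config N → ℂ) (τ : Config N) :
    diff (ann i ψ) τ + ann i (diff ψ) τ = ψ τ := by
  cases hi : τ i with
  | true =>
    have h2 : ann i (diff ψ) τ = 0 := by simp [ann, hi]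
    rw [h2, add_zero, diff_apply, Finset.sum_eq_single i]
    · rw [if_pos hi]
      simp only [ann, Function.update_self, if_true, update_false_true hi]
      rw [sgn_update_of_le _ le_rfl, ← mul_assoc, sgn_mul_self, one_mul]
    · intro x _ hx
      simp [ann, Function.update_of_ne hx.symm, hi]
    · simp
  | false =>
    have h2 : ann i (diff ψ) τ = sgn τ i * diff ψ (Function.update τ i true) := by
      simp [ann, hi]
    rw [h2, diff_apply, diff_apply, Finset.mul_sum, ← Finset.sum_add_distrib,
      Finset.sum_eq_single i]
    · rw [if_neg (by simp [hi]), if_pos (by simp), update_true_false hi,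
        sgn_update_of_le _ le_rfl, ← mul_assoc, sgn_mul_self, one_mul, zero_add]
    · intro x _ hx
      rw [Function.update_of_ne hx]
      cases hτ : τ x with
      | false => simp
      | true =>
        simp only [if_true, ann, Function.update_of_ne hx.symm, hi]
        rw [Function.update_comm hx]
        rcases lt_or_gt_of_ne hx with h | h
        · rw [sgn_update_false _ h hτ, sgn_update_of_le _ h.le]
          ring
        · rw [sgn_update_true _ h hi, sgn_update_of_le _ h.le]
          ring
    · simp

lemma fermions_update_false {σ : Config N} {i : Fin N} (h : σ i = true) :
    fermions (Function.update σ i false) + 1 = fermions σ := by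
  unfold fermions
  have : (Finset.univ.filter fun k => σ k = true) =
      insert i (Finset.univ.filter fun k => Function.update σ i false k = true) := by
    ext k
    by_cases hk : k = i
    · subst hk; simp [h]
    · simp [hk]
  rw [this, Finset.card_insert_of_notMem (by simp)]

lemma diff_gradePart (f : ℕ) (ψ : Config N → ℂ) :
    diff (gradePart f ψ) = gradePart (f + 1) (diff ψ) := by
  ext τ
  simp only [gradePart, diff_apply]
  split_ifs with hf
  · refine Finset.sum_congr rfl fun i _ => ?_
    split_ifs with h h'
    · rfl
    · have := fermions_update_false h
      omega
    · rfl
  · refine Finset.sum_eq_zero fun i _ => ?_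
    split_ifs with h h'
    · have := fermions_update_false h
      omega
    · rw [mul_zero]
    · rfl

lemma gradePart_zero_diff (ψ : Config N → ℂ) : gradePart 0 (diff ψ) = 0 := by
  ext τ
  simp only [gradePart, diff_apply, Pi.zero_apply]
  split_ifs with hf
  · refine Finset.sum_eq_zero fun i _ => if_neg fun h => ?_
    have := fermions_update_false h
    omega
  · rfl

lemma ann_diff_diff (i : Fin N) (ψ : Config N → ℂ) :
    ann i (diff (diff ψ)) = diff (diff (ann i ψ)) := by
  have key (φ : Config N → ℂ) : ann i (diff φ) = φ - diff (ann i φ) := by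
    ext τ
    simp [← diff_ann_add_ann_diff i φ τ]
  rw [key, key, map_sub, sub_sub_cancel]

lemma diff_diff_apply (n : ℕ) : ∀ (ψ : Config N → ℂ) (τ : Config N), fermions τ = n →
    diff (diff ψ) τ = 0 := by
  induction n with
  | zero =>
    intro ψ τ hτ
    rw [diff_apply]
    refine Finset.sum_eq_zero fun i _ => if_neg fun h => ?_
    have := fermions_update_false h
    omega
  | succ n ih =>
    intro ψ τ hτ
    have : ∃ i, τ i = true := by
      by_contra! h
      simp [fermions, h] at hτ
    obtain ⟨i, hi⟩ := this
    have h1 := congrFun (ann_diff_diff i ψ) (Function.update τ i false)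
    rw [ih _ _ (by have := fermions_update_false hi; omega)] at h1
    simp only [ann, Function.update_self, if_true, update_false_true hi] at h1
    refine (mul_eq_zero.1 h1).resolve_left fun h => ?_
    have := sgn_mul_self (Function.update τ i false) i
    simp [h] at this

lemma diff_diff (ψ : Config N → ℂ) : diff (diff ψ) = 0 :=
  funext fun τ => diff_diff_apply _ ψ τ rfl

lemma diff_congr {P : Config N → Prop} (hP : Down P) {ψ φ : Config N → ℂ}
    (h : ∀ σ, P σ → ψ σ = φ σ) {τ : Config N} (hτ : P τ) : diff ψ τ = diff φ τ := by
  rw [diff_apply, diff_apply]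
  refine Finset.sum_congr rfl fun i _ => ?_
  rw [h _ (hP τ i hτ)]

/-- Every cocycle on the configurations in `P` is exact. -/
def Acyclic (P : Config N → Prop) : Prop :=
  ∀ ψ : Config N → ℂ, (∀ σ, P σ → diff ψ σ = 0) →
    ∃ ξ : Config N → ℂ, ∀ σ, P σ → diff ξ σ = ψ σ

/-- The cohomology on the configurations in `P` is spanned by a single nonzero class, of
fermion number `g`. -/
def OneClass (P : Config N → Prop) (g : ℕ) : Prop :=
  ∃ ω : Config N → ℂ, gradePart g ω = ω ∧ (∀ σ, P σ → diff ω σ = 0) ∧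
    (¬ ∃ ξ : Config N → ℂ, ∀ σ, P σ → diff ξ σ = ω σ) ∧
    ∀ ψ : Config N → ℂ, (∀ σ, P σ → diff ψ σ = 0) →
      ∃ (c : ℂ) (ξ : Config N → ℂ), ∀ σ, P σ → ψ σ = c * ω σ + diff ξ σ

/-- `P'` is an enlargement of `P` by configurations that come in pairs differing at site `i`
only. -/
structure PairedAt (i : Fin N) (P P' : Config N → Prop) : Prop where
  down : Down P
  down' : Down P'
  le : ∀ σ, P σ → P' σ
  update : ∀ σ b, P' σ → ¬ P σ →
    P' (Function.update σ i b) ∧ ¬ P (Function.update σ i b)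

namespace PairedAt

variable {i : Fin N} {P P' : Config N → Prop}

lemma exists_primitive (H : PairedAt i P P') {η : Config N → ℂ}
    (h0 : ∀ σ, P σ → η σ = 0) (h1 : ∀ σ, P' σ → diff η σ = 0) :
    ∃ h : Config N → ℂ, (∀ σ, P σ → h σ = 0) ∧ ∀ σ, P' σ → diff h σ = η σ := by
  refine ⟨fun σ => if P σ then 0 else ann i η σ, fun σ hσ => if_pos hσ, fun τ hτ => ?_⟩
  by_cases hP : P τ
  · rw [h0 τ hP, diff_congr H.down (φ := 0) (fun σ hσ => by simp [hσ]) hP, map_zero]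
    rfl
  have hcut : diff (fun σ => if P σ then 0 else ann i η σ) τ = diff (ann i η) τ := by
    rw [diff_apply, diff_apply]
    refine Finset.sum_congr rfl fun x _ => ?_
    split_ifs with hx hPx
    · have : ann i η (Function.update τ x false) = 0 := by
        rw [ann]
        split_ifs with hi
        · rw [h0, mul_zero]
          by_contra hn
          by_cases hxi : x = i
          · subst hxi
            have := (H.update _ false hτ hP).2
            exact this hPx
          · refine (H.update _ false ?_ hn).2 ?_
            · rw [Function.update_comm hxi]
              exact H.down' _ _ (H.update τ true hτ hP).1
            · rwa [update_true_false hi]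
        · rfl
      rw [this]
    · rfl
    · rfl
  rw [hcut, ← diff_ann_add_ann_diff i η τ, left_eq_add, ann]
  split_ifs
  · rw [h1 _ (H.update τ true hτ hP).1, mul_zero]
  · rfl

lemma exists_extension (H : PairedAt i P P') {ψ : Config N → ℂ}
    (h : ∀ σ, P σ → diff ψ σ = 0) :
    ∃ φ : Config N → ℂ, (∀ σ, P σ → φ σ = ψ σ) ∧ ∀ σ, P' σ → diff φ σ = 0 := by
  obtain ⟨η, h0, h1⟩ := H.exists_primitive h fun σ _ => congrFun (diff_diff ψ) σ
  refine ⟨ψ - η, fun σ hσ => ?_, fun σ hσ => ?_⟩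
  · rw [Pi.sub_apply, h0 σ hσ, sub_zero]
  · rw [map_sub, Pi.sub_apply, h1 σ hσ, sub_self]

lemma exact_of_exact (H : PairedAt i P P') {ψ : Config N → ℂ}
    (h : ∀ σ, P' σ → diff ψ σ = 0) (hex : ∃ ξ : Config N → ℂ, ∀ σ, P σ → diff ξ σ = ψ σ) :
    ∃ ξ : Config N → ℂ, ∀ σ, P' σ → diff ξ σ = ψ σ := by
  obtain ⟨ξ, hξ⟩ := hex
  obtain ⟨η, -, h1⟩ := H.exists_primitive (η := ψ - diff ξ)
    (fun σ hσ => by simp [hξ σ hσ]) (fun σ hσ => by simp [diff_diff, h σ hσ])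
  refine ⟨ξ + η, fun σ hσ => ?_⟩
  simp [h1 σ hσ]

lemma acyclic_smaller (H : PairedAt i P P') (h : Acyclic P') : Acyclic P := fun ψ hψ => by
  obtain ⟨φ, h0, h1⟩ := H.exists_extension hψ
  obtain ⟨ξ, hξ⟩ := h φ h1
  exact ⟨ξ, fun σ hσ => by rw [hξ σ (H.le σ hσ), h0 σ hσ]⟩

lemma oneClass_smaller (H : PairedAt i P P') {g : ℕ} (h : OneClass P' g) :
    OneClass P g := by
  obtain ⟨ω, hg, hd, hn, hs⟩ := h
  refine ⟨ω, hg, fun σ hσ => hd σ (H.le σ hσ), fun hex => hn (H.exact_of_exact hd hex),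
    fun ψ hψ => ?_⟩
  obtain ⟨φ, h0, h1⟩ := H.exists_extension hψ
  obtain ⟨c, ξ, hc⟩ := hs φ h1
  exact ⟨c, ξ, fun σ hσ => by rw [← h0 σ hσ, hc σ (H.le σ hσ)]⟩

end PairedAt

lemma acyclic_true (i : Fin N) : Acyclic fun _ : Config N => True := fun ψ hψ =>
  ⟨ann i ψ, fun σ _ => by
    rw [← diff_ann_add_ann_diff i ψ σ, left_eq_add, ann, hψ _ trivial, mul_zero, ite_self]⟩

lemma update_false_ne {e : Config N} {x : Fin N} (hx : e x = true) :
    Function.update e x false ≠ e := fun h => by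
  have := congrFun h x
  simp [hx] at this

/-- Removing a single configuration from an acyclic family creates one cohomology class. -/
lemma Acyclic.oneClass_remove {P P' : Config N → Prop} {e : Config N} {g : ℕ}
    (h : Acyclic P') (hP : Down P) (hP' : Down P') (hPe : ¬ P e)
    (hiff : ∀ σ, P' σ ↔ P σ ∨ σ = e) (hg : fermions e = g + 1) : OneClass P g := by
  have hle (σ) (hσ : P σ) : P' σ := (hiff σ).2 (Or.inl hσ)
  have hP'e : P' e := (hiff e).2 (Or.inr rfl)
  have hcl (σ) (hσ : P' σ) : diff (Pi.single e 1 : Config N → ℂ) σ = 0 := by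
    rw [diff_apply]
    refine Finset.sum_eq_zero fun x _ => ?_
    split_ifs with hx
    · by_cases he : Function.update σ x false = e
      · rcases (hiff σ).1 hσ with hσ | rfl
        · exact absurd (he ▸ hP σ x hσ) hPe
        · exact absurd he (update_false_ne hx)
      · rw [Pi.single_eq_of_ne he, mul_zero]
    · rfl
  obtain ⟨ξ, hξ⟩ := h _ hcl
  have hω (σ) (hσ : P' σ) : diff (gradePart g ξ) σ = (Pi.single e 1 : Config N → ℂ) σ := by
    rw [diff_gradePart, gradePart]
    split_ifs with hf
    · exact hξ σ hσ
    · rw [Pi.single_eq_of_ne]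
      rintro rfl
      exact hf hg
  refine ⟨gradePart g ξ, ?_, fun σ hσ => ?_, ?_, fun ψ hψ => ?_⟩
  · ext σ
    simp only [gradePart]
    split_ifs <;> rfl
  · rw [hω σ (hle σ hσ), Pi.single_eq_of_ne]
    rintro rfl
    exact hPe hσ
  · rintro ⟨ζ, hζ⟩
    have h1 : diff (gradePart g ξ) e = diff (diff ζ) e := by
      rw [diff_apply, diff_apply]
      refine Finset.sum_congr rfl fun x _ => ?_
      split_ifs with hx
      · rw [hζ]
        exact ((hiff _).1 (hP' e x hP'e)).resolve_right (update_false_ne hx)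
      · rfl
    rw [hω e hP'e, diff_diff] at h1
    simp at h1
  · obtain ⟨ζ, hζ⟩ := h (ψ - diff ψ e • gradePart g ξ) fun σ hσ => by
      rw [map_sub, map_smul, Pi.sub_apply, Pi.smul_apply, hω σ hσ]
      rcases (hiff σ).1 hσ with h' | rfl
      · rw [hψ σ h', Pi.single_eq_of_ne]
        · simp
        · rintro rfl
          exact hPe h'
      · simp
    refine ⟨diff ψ e, ζ, fun σ hσ => ?_⟩
    rw [hζ σ (hle σ hσ)]
    simp

/-- Extension by zero of a state to all configurations. -/
def extend {P : Config N → Prop} (ψ : AState N P) : Config N → ℂ := fun σ =>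
  if h : P σ then ψ ⟨σ, h⟩ else 0

/-- Restriction to the configurations in `P`. -/
def restrict (P : Config N → Prop) (ψ : Config N → ℂ) : AState N P := fun σ => ψ σ.1

lemma restrict_extend {P : Config N → Prop} (ψ : AState N P) :
    restrict P (extend ψ) = ψ := by
  ext σ
  simp [restrict, extend, σ.2]

lemma Qop_restrict {P : Config N → Prop} (hP : Down P) (ψ : Config N → ℂ) :
    Qop N P (fun _ => True) (restrict P ψ) = restrict P (diff ψ) := by
  ext ⟨τ, hτ⟩
  simp only [Qop, QopA, Matrix.mulVecLin_apply, Matrix.mulVec, dotProduct, QmatA, restrict,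
    diff_apply, Finset.sum_mul]
  rw [Finset.sum_comm]
  refine Finset.sum_congr rfl fun i _ => ?_
  split_ifs with hi
  · rw [Finset.sum_eq_single ⟨Function.update τ i false, hP τ i hτ⟩]
    · simp [update_false_true hi, sgn_update_of_le]
    · rintro ⟨σ, hσ⟩ _ hne
      rw [if_neg, zero_mul]
      rintro ⟨-, h0, rfl⟩
      exact hne (Subtype.ext (update_true_false h0).symm)
    · simp
  · refine Finset.sum_eq_zero fun σ _ => ?_
    rw [if_neg, zero_mul]
    rintro ⟨-, -, rfl⟩
    simp at hi

lemma Qop_eq {P : Config N → Prop} (hP : Down P) (ψ : AState N P) :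
    Qop N P (fun _ => True) ψ = restrict P (diff (extend ψ)) := by
  rw [← Qop_restrict hP, restrict_extend]

lemma restrict_mem_gradeV (P : Config N → Prop) (f : ℕ) (ψ : Config N → ℂ) :
    restrict P (gradePart f ψ) ∈ gradeV N P f := fun _ hσ => if_neg hσ

lemma restrict_diff_mem_cobounds {P : Config N → Prop} (hP : Down P) (f : ℕ)
    (ξ : Config N → ℂ) :
    restrict P (gradePart f (diff ξ)) ∈ cobounds N P (fun _ => True) f := by
  cases f with
  | zero =>
    rw [gradePart_zero_diff]
    exact Submodule.zero_mem _
  | succ f =>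
    rw [← diff_gradePart, ← Qop_restrict hP]
    exact Submodule.mem_map_of_mem (restrict_mem_gradeV P f ξ)

lemma restrict_gradePart_extend {P : Config N → Prop} {f : ℕ} {ψ : AState N P}
    (h : ψ ∈ gradeV N P f) : restrict P (gradePart f (extend ψ)) = ψ := by
  ext σ
  simp only [restrict, gradePart]
  split_ifs with hf
  · exact congrFun (restrict_extend ψ) σ
  · exact (h σ hf).symm

lemma OneClass.cohDim_eq {P : Config N → Prop} {g : ℕ} (h : OneClass P g) (hP : Down P)
    (f : ℕ) : cohDim N P (fun _ => True) f = if f = g then 1 else 0 := by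
  obtain ⟨ω, hg, hd, hn, hs⟩ := h
  have hs' (ψ : AState N P) (hψ : ψ ∈ cocycles N P (fun _ => True) f) :
      ∃ c : ℂ, ψ - c • restrict P (gradePart f ω) ∈ cobounds N P (fun _ => True) f := by
    obtain ⟨c, ξ, hc⟩ := hs (extend ψ) fun σ hσ => by
      have := (Qop_eq hP ψ).symm.trans (LinearMap.mem_ker.1 hψ.1)
      exact congrFun this ⟨σ, hσ⟩
    refine ⟨c, ?_⟩
    convert restrict_diff_mem_cobounds hP f ξ using 1
    conv_lhs => rw [← restrict_gradePart_extend hψ.2]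
    ext σ
    simp only [restrict, gradePart, Pi.sub_apply, Pi.smul_apply, smul_eq_mul]
    split_ifs
    · rw [hc _ σ.2]
      ring
    · ring
  unfold cohDim
  split_ifs with hfg
  · subst hfg
    rw [hg] at hs'
    have hω : restrict P ω ∈ cocycles N P (fun _ => True) f := by
      refine ⟨LinearMap.mem_ker.2 ?_, hg ▸ restrict_mem_gradeV P f ω⟩
      rw [Qop_restrict hP]
      ext σ
      exact hd _ σ.2
    refine (finrank_eq_one_iff_of_nonzero' (Submodule.Quotient.mk ⟨_, hω⟩) ?_).2 ?_
    · rw [Ne, Submodule.Quotient.mk_eq_zero, Submodule.mem_comap]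
      rintro ⟨ξ, -, hξ⟩
      refine hn ⟨extend ξ, fun σ hσ => ?_⟩
      rw [Qop_eq hP] at hξ
      exact congrFun hξ ⟨σ, hσ⟩
    · intro w
      obtain ⟨ψ, rfl⟩ := Submodule.Quotient.mk_surjective _ w
      obtain ⟨c, hc⟩ := hs' ψ.1 ψ.2
      refine ⟨c, ?_⟩
      rw [← Submodule.Quotient.mk_smul]
      exact ((Submodule.Quotient.eq _).2 (Submodule.mem_comap.2 hc)).symm
  · have h0 : gradePart f ω = 0 := by
      rw [← hg]
      ext σ
      simp only [gradePart, Pi.zero_apply]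
      split_ifs <;> first | rfl | omega
    have : Subsingleton (CohSpace N P (fun _ => True) f) := by
      rw [Submodule.Quotient.subsingleton_iff, eq_top_iff]
      rintro ⟨ψ, hψ⟩ -
      obtain ⟨c, hc⟩ := hs' ψ hψ
      rwa [h0, show restrict P 0 = 0 from rfl, smul_zero, sub_zero] at hc
    exact Module.finrank_zero_of_subsingleton

/-- All empty sites lie in a window of `m` consecutive sites of the open chain. -/
def Close (m : ℕ) (σ : Config N) : Prop :=
  ∀ i j, σ i = false → σ j = false → j.1 < i.1 + m

/-- All empty sites have their position in `s`. -/
def HolesIn (s : Set ℕ) (σ : Config N) : Prop :=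
  ∀ j, σ j = false → j.1 ∈ s

lemma not_perOK_iff {ℓ : ℕ} (hℓ : ℓ < N) (σ : Config N) :
    ¬ PerOK N ℓ σ ↔ ∃ i < N, ∀ j : Fin N, i ≤ j.1 ∧ j.1 ≤ i + ℓ ∨ j.1 + N ≤ i + ℓ →
      σ j = true := by
  simp only [PerOK, not_forall, not_exists, not_and, Bool.not_eq_false]
  constructor
  · rintro ⟨i, hi⟩
    refine ⟨i, i.2, ?_⟩
    rintro j (h | h)
    · convert hi (j - i) (by omega)
      ext
      simp only [cyc]
      rw [Nat.mod_eq_of_lt] <;> omega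
    · convert hi (j + N - i) (by omega)
      ext
      simp only [cyc]
      rw [Nat.mod_eq_sub_mod (by omega), Nat.mod_eq_of_lt] <;> omega
  · rintro ⟨i, hi, h⟩
    refine ⟨⟨i, hi⟩, fun k hk => h _ ?_⟩
    simp only [cyc]
    by_cases hk' : i + k < N
    · rw [Nat.mod_eq_of_lt hk']
      omega
    · rw [Nat.mod_eq_sub_mod (by omega), Nat.mod_eq_of_lt] <;> omega

lemma Close.of_update {m : ℕ} {σ : Config N} {i : Fin N}
    (h : Close m (Function.update σ i false)) : Close m σ := fun a b ha hb =>
  h a b (by simp [Function.update_apply, ha]) (by simp [Function.update_apply, hb])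

lemma HolesIn.of_update {s : Set ℕ} {σ : Config N} {i : Fin N}
    (h : HolesIn s (Function.update σ i false)) : HolesIn s σ := fun a ha =>
  h a (by simp [Function.update_apply, ha])

lemma down_not {K : Config N → Prop} (h : ∀ σ i, K (Function.update σ i false) → K σ) :
    Down fun σ => ¬ K σ := fun σ i hσ hK => hσ (h σ i hK)

lemma down_not_close (m : ℕ) (s : Set ℕ) :
    Down fun σ : Config N => ¬ (Close m σ ∨ HolesIn s σ) :=
  down_not fun _ _ => Or.imp Close.of_update HolesIn.of_update

lemma down_not_close_and (m : ℕ) (s : Set ℕ) :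
    Down fun σ : Config N => ¬ (Close m σ ∧ HolesIn s σ) :=
  down_not fun _ _ => And.imp Close.of_update HolesIn.of_update

lemma down_perOK (ℓ : ℕ) : Down (PerOK N ℓ) := fun σ i hσ j => by
  obtain ⟨k, hk, h⟩ := hσ j
  exact ⟨k, hk, by simp [Function.update_apply, h]⟩

/-- `PairedAt` from a description of the added configurations that does not see site `i`. -/
lemma PairedAt.of_iff {i : Fin N} {P P' R : Config N → Prop} (hP : Down P) (hP' : Down P')
    (hle : ∀ σ, P σ → P' σ) (hR : ∀ σ, P' σ ∧ ¬ P σ ↔ R σ)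
    (hi : ∀ σ b, R σ → R (Function.update σ i b)) : PairedAt i P P' :=
  ⟨hP, hP', hle, fun σ b h h' => (hR _).2 (hi σ b ((hR σ).1 ⟨h, h'⟩))⟩

section Midsize

variable {ℓ m : ℕ}

lemma Close.exists_window {σ : Config N} (h : Close m σ) (hN : N = m + ℓ + 1) (hm : 2 ≤ m) :
    ∃ i < N, ∀ j : Fin N, i ≤ j.1 ∧ j.1 ≤ i + ℓ ∨ j.1 + N ≤ i + ℓ → σ j = true := by
  by_cases h0 : ∃ t, σ t = false
  · obtain ⟨t, ht, hmin⟩ := Finset.exists_min_image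
      (Finset.univ.filter fun j => σ j = false) Fin.val (by simpa [Finset.Nonempty] using h0)
    simp only [Finset.mem_filter, Finset.mem_univ, true_and] at ht hmin
    refine ⟨if t.1 + m < N then t.1 + m else 0, by split_ifs <;> omega, fun j hj => ?_⟩
    by_contra hj'
    rw [Bool.not_eq_true] at hj'
    have := hmin j hj'
    have := h t j ht hj'
    split_ifs at hj <;> omega
  · push Not at h0
    exact ⟨0, by omega, fun j _ => by simpa using h0 j⟩

lemma pairedAt_perOK (hN : N = m + ℓ + 1) (hm : 2 ≤ m) (hmℓ : m ≤ ℓ + 1) :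
    PairedAt (⟨0, by omega⟩ : Fin N) (PerOK N ℓ)
      fun σ => ¬ (Close m σ ∨ HolesIn {j | j = 0 ∨ ℓ + 1 < j} σ) := by
  refine PairedAt.of_iff (R := fun σ => ∃ (s : ℕ) (a b : Fin N), 0 < a.1 ∧ a.1 < s ∧
    s + ℓ < b.1 ∧ σ a = false ∧ σ b = false ∧
    ∀ j : Fin N, s ≤ j.1 → j.1 ≤ s + ℓ → σ j = true)
    (down_perOK ℓ) (down_not_close _ _) ?_ ?_ ?_
  · intro σ hσ
    by_contra! h
    refine (not_perOK_iff (by omega) σ).2 ?_ hσ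
    rcases h with h | h
    · exact h.exists_window hN hm
    · refine ⟨1, by omega, fun j hj => ?_⟩
      by_contra hj'
      have : j.1 = 0 ∨ ℓ + 1 < j.1 := h j (by simpa using hj')
      omega
  · intro σ
    rw [not_perOK_iff (by omega)]
    constructor
    · rintro ⟨h1, i, hi, hw⟩
      have hw' (j : Fin N) (hj : σ j = false) :
          ¬ (i ≤ j.1 ∧ j.1 ≤ i + ℓ ∨ j.1 + N ≤ i + ℓ) := fun h => by
        simp [hw j h] at hj
      simp only [not_or, Close, HolesIn, not_forall, Set.mem_ofPred_eq] at h1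
      obtain ⟨⟨c, d, hc, hd, hcd⟩, a, ha, ha1, ha2⟩ := h1
      have h1 := hw' c hc
      have h2 := hw' d hd
      have h3 := hw' a ha
      exact ⟨i, a, d, by omega, by omega, by omega, ha, hd,
        fun j hj hj' => hw j (Or.inl ⟨hj, hj'⟩)⟩
    · rintro ⟨s, a, b, h1, h2, h3, ha, hb, hw⟩
      refine ⟨?_, s, by omega, fun j hj => hw j (by omega) (by omega)⟩
      rintro (h | h)
      · have := h a b ha hb
        omega
      · have : a.1 = 0 ∨ ℓ + 1 < a.1 := h a ha
        omega
  · rintro σ c ⟨s, a, b, h1, h2, h3, ha, hb, hw⟩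
    refine ⟨s, a, b, h1, h2, h3, ?_, ?_, fun j hj hj' => ?_⟩ <;>
      rw [Function.update_of_ne (by rw [Ne, Fin.ext_iff]; dsimp only; omega)]
    · exact ha
    · exact hb
    · exact hw j hj hj'

lemma pairedAt_not_close (hN : N = m + ℓ + 1) (hm : 2 ≤ m) (hmℓ : m ≤ ℓ + 1) :
    PairedAt (⟨N - 1, by omega⟩ : Fin N)
      (fun σ => ¬ (Close m σ ∨ HolesIn {j | j = 0 ∨ ℓ + 1 < j} σ))
      fun σ => ¬ (Close m σ ∨ HolesIn {j | j = 0 ∨ j = N - 1} σ) := by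
  refine PairedAt.of_iff (R := fun σ => ∃ a b : Fin N, a.1 = 0 ∧ ℓ + 1 < b.1 ∧ b.1 + 1 < N ∧
    σ a = false ∧ σ b = false ∧ HolesIn {j | j = 0 ∨ ℓ + 1 < j} σ)
    (down_not_close _ _) (down_not_close _ _) ?_ ?_ ?_
  · intro σ hσ h
    refine hσ (h.imp_right fun h j hj => ?_)
    have : j.1 = 0 ∨ j.1 = N - 1 := h j hj
    show j.1 = 0 ∨ ℓ + 1 < j.1
    omega
  · intro σ
    rw [not_not]
    constructor
    · rintro ⟨h1, h2⟩
      simp only [not_or, Close, HolesIn, not_forall, Set.mem_ofPred_eq] at h1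
      obtain ⟨⟨c, d, hc, hd, hcd⟩, b, hb, hb1, hb2⟩ := h1
      have hK : HolesIn {j | j = 0 ∨ ℓ + 1 < j} σ :=
        h2.resolve_left fun h => hcd (h c d hc hd)
      have h3 : c.1 = 0 ∨ ℓ + 1 < c.1 := hK c hc
      have h4 : b.1 = 0 ∨ ℓ + 1 < b.1 := hK b hb
      exact ⟨c, b, by omega, by omega, by omega, hc, hb, hK⟩
    · rintro ⟨a, b, h1, h2, h3, ha, hb, h⟩
      refine ⟨?_, Or.inr h⟩
      rintro (h' | h')
      · have := h' a b ha hb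
        omega
      · have : b.1 = 0 ∨ b.1 = N - 1 := h' b hb
        omega
  · rintro σ c ⟨a, b, h1, h2, h3, ha, hb, h⟩
    refine ⟨a, b, h1, h2, h3, ?_, ?_, fun j hj => ?_⟩
    · rwa [Function.update_of_ne (by rw [Ne, Fin.ext_iff]; dsimp only; omega)]
    · rwa [Function.update_of_ne (by rw [Ne, Fin.ext_iff]; dsimp only; omega)]
    · by_cases hjN : j.1 = N - 1
      · show j.1 = 0 ∨ ℓ + 1 < j.1
        omega
      · rw [Function.update_of_ne (by rw [Ne, Fin.ext_iff]; exact hjN)] at hj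
        exact h j hj

lemma acyclic_close_and_lt (hm : 2 ≤ m) (t : ℕ) (ht : t < N) :
    Acyclic fun σ : Config N => ¬ (Close m σ ∧ HolesIn {j | j < t + 1} σ) := by
  induction t with
  | zero =>
    refine PairedAt.acyclic_smaller (i := ⟨0, ht⟩) (PairedAt.of_iff
      (R := HolesIn {j | j < 1}) (down_not_close_and _ _) (fun _ _ => id) (fun _ _ => trivial)
      (fun σ => ?_) fun σ c h j hj => ?_) (acyclic_true ⟨0, ht⟩)
    · rw [not_not]
      refine ⟨fun h => h.2.2, fun h => ⟨trivial, fun a b ha hb => ?_, h⟩⟩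
      have : a.1 < 1 := h a ha
      have : b.1 < 1 := h b hb
      omega
    · by_cases hj0 : j.1 = 0
      · show j.1 < 1
        omega
      · rw [Function.update_of_ne (by rw [Ne, Fin.ext_iff]; exact hj0)] at hj
        exact h j hj
  | succ t ih =>
    refine PairedAt.acyclic_smaller (i := ⟨t, by omega⟩) (PairedAt.of_iff
      (R := fun σ => σ ⟨t + 1, ht⟩ = false ∧
        ∀ j, σ j = false → j.1 ≤ t + 1 ∧ t + 1 < j.1 + m)
      (down_not_close_and _ _) (down_not_close_and _ _)
      (fun σ h h' => h ⟨h'.1, fun j hj => Nat.lt_succ_of_lt (h'.2 j hj)⟩)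
      (fun σ => ?_) fun σ c h => ?_) (ih (by omega))
    · rw [not_not]
      constructor
      · rintro ⟨h1, h2, h3⟩
        simp only [h2, true_and, HolesIn, not_forall, Set.mem_ofPred_eq] at h1
        obtain ⟨b, hb, hb'⟩ := h1
        have h4 : b.1 < t + 1 + 1 := h3 b hb
        obtain rfl : b = ⟨t + 1, ht⟩ := Fin.ext (by dsimp only; omega)
        refine ⟨hb, fun j hj => ⟨?_, h2 j _ hj hb⟩⟩
        exact Nat.lt_succ_iff.1 (h3 j hj)
      · rintro ⟨h1, h2⟩
        refine ⟨fun h => ?_, fun a b ha hb => ?_, fun j hj => Nat.lt_succ_of_le (h2 j hj).1⟩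
        · have : t + 1 < t + 1 := h.2 _ h1
          omega
        · have := h2 a ha
          have := h2 b hb
          omega
    · refine ⟨?_, fun j hj => ?_⟩
      · rw [Function.update_of_ne (by simp)]
        exact h.1
      · by_cases hjt : j.1 = t
        · omega
        · rw [Function.update_of_ne (by rw [Ne, Fin.ext_iff]; exact hjt)] at hj
          exact h.2 j hj

lemma acyclic_not_close (hm : 2 ≤ m) (hN : 0 < N) :
    Acyclic fun σ : Config N => ¬ Close m σ := by
  convert acyclic_close_and_lt (N := N) hm (N - 1) (by omega) using 4 with σ
  refine (and_iff_left fun j _ => ?_).symm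
  show j.1 < N - 1 + 1
  omega

lemma oneClass_perOK (hN : N = m + ℓ + 1) (hm : 2 ≤ m) (hmℓ : m ≤ ℓ + 1) :
    OneClass (PerOK N ℓ) (N - 3) := by
  refine (pairedAt_perOK hN hm hmℓ).oneClass_smaller
    ((pairedAt_not_close hN hm hmℓ).oneClass_smaller ?_)
  set e : Config N := fun j => decide (j.1 ≠ 0 ∧ j.1 ≠ N - 1) with he
  have he0 (j : Fin N) : e j = false ↔ j.1 = 0 ∨ j.1 = N - 1 := by
    simp only [he, decide_eq_false_iff_not]
    omega
  have heC : ¬ Close m e := fun h => by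
    have := h ⟨0, by omega⟩ ⟨N - 1, by omega⟩ ((he0 _).2 (Or.inl rfl)) ((he0 _).2 (Or.inr rfl))
    dsimp only at this
    omega
  refine (acyclic_not_close hm (by omega)).oneClass_remove (e := e) (down_not_close _ _)
    (down_not fun _ _ => Close.of_update) ?_ (fun σ => ?_) ?_
  · rw [not_not]
    exact Or.inr fun j hj => (he0 j).1 hj
  · constructor
    · intro h
      by_cases hH : HolesIn {j | j = 0 ∨ j = N - 1} σ
      · right
        simp only [Close, not_forall] at h
        obtain ⟨c, d, hc, hd, hcd⟩ := h
        have h1 : c.1 = 0 ∨ c.1 = N - 1 := hH c hc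
        have h2 : d.1 = 0 ∨ d.1 = N - 1 := hH d hd
        have h3 (j : Fin N) : σ j = false ↔ e j = false := by
          rw [he0]
          refine ⟨fun hj => hH j hj, fun hj => ?_⟩
          rcases hj with hj | hj
          · rwa [show j = c from Fin.ext (by omega)]
          · rwa [show j = d from Fin.ext (by omega)]
        ext j
        have := h3 j
        cases h4 : σ j <;> cases h5 : e j <;> simp_all
      · exact Or.inl (not_or.2 ⟨h, hH⟩)
    · rintro (h | rfl)
      · exact fun hC => h (Or.inl hC)
      · exact heC
  · have : (Finset.univ.filter fun j => e j = true) =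
        Finset.univ \ {(⟨0, by omega⟩ : Fin N), ⟨N - 1, by omega⟩} := by
      ext j
      simp [he, Fin.ext_iff]
    rw [fermions, this, Finset.card_univ_sdiff, Finset.card_pair, Fintype.card_fin]
    · omega
    · simp only [Ne, Fin.mk.injEq]
      omega

end Midsize

end Config

/-- Cohomology of closed chains of length `ℓ+3 ≤ N ≤ 2ℓ+2` with periodic boundary
conditions: it is one-dimensional and concentrated at fermion number `N-3`. -/
theorem cohomology_periodic_midsize_chain (ℓ N : ℕ) (hℓ : 1 ≤ ℓ)
    (hN1 : ℓ + 3 ≤ N) (hN2 : N ≤ 2 * ℓ + 2) :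
    ∀ f, cohDim N (PerOK N ℓ) (fun _ => True) f = if f = N - 3 then 1 else 0 := by
  exact (Config.oneClass_perOK (m := N - ℓ - 1) (by omega) (by omega) (by omega)).cohDim_eq
    (Config.down_perOK ℓ)

end
end
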